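/- arXiv:2010.13079 — 2 statements merged into one kernel-verified Lean document; each statement's English description precedes it below -/
import Mathlib

section
/- Let q = p^e be a power of a prime with q ≡ 1 (mod 4) and set t = (q-1)/4. For every λ ∈ 𝔽_q with λ ≠ 0 and λ⁴ ≠ 1, the number of 𝔽_q-rational points on the Dwork hypersurface X_λ⁴ satisfies: #X_λ⁴(𝔽_q) = (q³-1)/(q-1) + 12·q·ω^t(-1)·ω^{2t}(1-λ⁴) + q²·₃F₂(ω^t,ω^{2t},ω^{3t}; ε,ε | 1/λ⁴)_q + 3·q²·binom(ω^{3t};ω^t)·₂F₁(ω^{3t},ω^t; ω^{2t} | 1/λ⁴)_q. -/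
open scoped Classical

noncomputable section

/-- The Gauss sum `g(χ) = ∑ₓ χ(x) exp(2π√-1 · tr(x)/p)` of a multiplicative character `χ`
of a finite field `F` of characteristic `p`, where `tr : F → 𝔽_p` is the trace map. -/
def gaussChar (p : ℕ) (F : Type) [Field F] [Fintype F] [Algebra (ZMod p) F]
    (χ : MulChar F ℂ) : ℂ :=
  ∑ x : F, χ x *
    Complex.exp (2 * Real.pi * Complex.I * ((Algebra.trace (ZMod p) F x).val : ℂ) / (p : ℂ))

/-- The Jacobi sum `J(χ₁, …, χₙ) = ∑_{x₁ + ⋯ + xₙ = 1} χ₁(x₁) ⋯ χₙ(xₙ)`. -/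
def jacobiS (F : Type) [Field F] [Fintype F] {n : ℕ} (χ : Fin n → MulChar F ℂ) : ℂ :=
  ∑ v ∈ Finset.univ.filter (fun v : Fin n → F => ∑ i, v i = 1), ∏ i, χ i (v i)

/-- The normalized Jacobi sum `binom(A; B) = (B(-1)/q) · J(A, B̄)`. -/
def gBinom (F : Type) [Field F] [Fintype F] (A B : MulChar F ℂ) : ℂ :=
  B (-1) / (Fintype.card F : ℂ) * jacobiS F ![A, B⁻¹]

/-- Greene's finite-field hypergeometric function `ₙ₊₁Fₙ` (case `n ≥ 2`), where the sum over all
multiplicative characters is written as a sum over the powers `ω^j`, `0 ≤ j ≤ q - 2`, of a fixed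
generator `ω` of the character group. -/
def greeneF (F : Type) [Field F] [Fintype F] (ω : MulChar F ℂ) {n : ℕ}
    (A : Fin (n + 1) → MulChar F ℂ) (B : Fin n → MulChar F ℂ) (x : F) : ℂ :=
  (Fintype.card F : ℂ) / ((Fintype.card F : ℂ) - 1) *
    ∑ j ∈ Finset.range (Fintype.card F - 1),
      gBinom F (A 0 * ω ^ j) (ω ^ j) *
        (∏ i : Fin n, gBinom F (A i.succ * ω ^ j) (B i * ω ^ j)) * (ω ^ j) x

/-- Greene's finite-field hypergeometric function `₂F₁` (case `n = 1`):
`₂F₁(A₀, A₁; B₁ | x) = ε(x) · (A₁B₁(-1)/q) · ∑_y A₁(y) (A̅₁B₁)(1-y) A̅₀(1-xy)`. -/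
def greene2F1 (F : Type) [Field F] [Fintype F] (A₀ A₁ B₁ : MulChar F ℂ) (x : F) : ℂ :=
  (1 : MulChar F ℂ) x * ((A₁ * B₁) (-1) / (Fintype.card F : ℂ)) *
    ∑ y : F, A₁ y * (A₁⁻¹ * B₁) (1 - y) * A₀⁻¹ (1 - x * y)

/-- The number of `F`-rational points of the Dwork hypersurface
`x₁^d + ⋯ + x_d^d = dλ x₁ ⋯ x_d` in projective space. -/
def dworkCount (F : Type) [Field F] [Fintype F] (d : ℕ) (lam : F) : ℕ :=
  Nat.card {P : Projectivization F (Fin d → F) //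
    ∑ i, P.rep i ^ d = (d : F) * lam * ∏ i, P.rep i}

/-- The number of `F`-rational points of the diagonal hypersurface
`x₁^d + ⋯ + xₙ^d = dλ x₁^{h₁} ⋯ xₙ^{hₙ}` in projective space. -/
def diagCount (F : Type) [Field F] [Fintype F] (d n : ℕ) (h : Fin n → ℕ) (lam : F) : ℕ :=
  Nat.card {P : Projectivization F (Fin n → F) //
    ∑ i, P.rep i ^ d = (d : F) * lam * ∏ i, P.rep i ^ h i}

/-- The quantity `N_q(0, w)` from Koblitz's formula, with `t = (q - 1)/d`. -/
def NqW (p : ℕ) (F : Type) [Field F] [Fintype F] [Algebra (ZMod p) F]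
    (ω : MulChar F ℂ) (d : ℕ) {n : ℕ} (w : Fin n → ZMod d) : ℂ :=
  if ∀ i, w i = 0 then ((Fintype.card F : ℂ) ^ (n - 1) - 1) / ((Fintype.card F : ℂ) - 1)
  else if ∀ i, w i ≠ 0 then
    (1 / (Fintype.card F : ℂ)) *
      ∏ i, gaussChar p F (ω ^ ((w i).val * ((Fintype.card F - 1) / d)))
  else 0

/-- The quantity `S_{[w]} = (q-1)⁻¹ ∑_{j=0}^{q-2} (∏ᵢ g(ω^{wᵢt + hᵢj}) / g(ω^{dj})) ω^{dj}(dλ)`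
from Koblitz's formula, with `t = (q - 1)/d`. -/
def SW (p : ℕ) (F : Type) [Field F] [Fintype F] [Algebra (ZMod p) F]
    (ω : MulChar F ℂ) (d : ℕ) {n : ℕ} (h : Fin n → ℕ) (w : Fin n → ZMod d) (lam : F) : ℂ :=
  ((Fintype.card F : ℂ) - 1)⁻¹ *
    ∑ j ∈ Finset.range (Fintype.card F - 1),
      (∏ i, gaussChar p F (ω ^ ((w i).val * ((Fintype.card F - 1) / d) + h i * j))) /
          gaussChar p F (ω ^ (d * j)) * (ω ^ (d * j)) ((d : F) * lam)

end


noncomputable instance dwMulCharFintype (F : Type) [Field F] [Fintype F] :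
    Fintype (MulChar F ℂ) := Fintype.ofFinite _

set_option linter.unusedSectionVars false

section DworkHelpers

variable {F : Type} [Field F] [Fintype F]

lemma dw_card_units : (Fintype.card Fˣ : ℂ) = (Fintype.card F : ℂ) - 1 := by
  rw [Fintype.card_units, Nat.cast_sub Fintype.card_pos]; simp

lemma dw_card_mulChar : Fintype.card (MulChar F ℂ) = Fintype.card F - 1 := by
  have h := MulChar.card_eq_card_units_of_hasEnoughRootsOfUnity F ℂ
  rw [Nat.card_eq_fintype_card, Nat.card_eq_fintype_card, Fintype.card_units] at h
  exact h

lemma dw_card_ne_zero : (Fintype.card F : ℂ) ≠ 0 := by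
  exact_mod_cast Fintype.card_ne_zero

lemma dw_card_sub_one_ne_zero : (Fintype.card F : ℂ) - 1 ≠ 0 := by
  rw [← dw_card_units]
  exact_mod_cast Fintype.card_ne_zero

/-- dual orthogonality -/
lemma dw_orth (a : Fˣ) :
    ∑ A : MulChar F ℂ, A (a : F) = if a = 1 then (Fintype.card F : ℂ) - 1 else 0 := by
  split_ifs with h
  · subst h
    simp [dw_card_mulChar, Nat.cast_sub (Fintype.card_pos (α := F))]
  · obtain ⟨χ, hχ⟩ := MulChar.exists_apply_ne_one_of_hasEnoughRootsOfUnity F ℂ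
      (a := (a : F)) (by simpa using h)
    have h1 : ∑ A : MulChar F ℂ, (χ * A) (a : F) = ∑ A : MulChar F ℂ, A (a : F) :=
      Fintype.sum_equiv (Equiv.mulLeft χ) _ _ (fun _ => rfl)
    simp only [MulChar.mul_apply, ← Finset.mul_sum] at h1
    have h2 : (χ (a : F) - 1) * ∑ A : MulChar F ℂ, A (a : F) = 0 := by
      rw [sub_mul, h1]; ring
    rcases mul_eq_zero.mp h2 with h3 | h3
    · exact absurd (sub_eq_zero.mp h3) hχ
    · exact h3

lemma dw_sum_units (f : F → ℂ) : ∑ x : F, f x = f 0 + ∑ x : Fˣ, f x := by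
  rw [Fintype.sum_eq_add_sum_compl (0 : F)]
  congr 1
  symm
  refine Finset.sum_bij (fun (x : Fˣ) _ => (x : F)) (by simp) (by
    intro a _ b _ h; exact Units.ext h) ?_ (by simp)
  intro b hb
  have hb' : b ≠ 0 := by simpa using hb
  exact ⟨Units.mk0 b hb', by simp, rfl⟩

lemma dw_sum_char_units (A : MulChar F ℂ) :
    ∑ x : Fˣ, A (x : F) = if A = 1 then (Fintype.card F : ℂ) - 1 else 0 := by
  split_ifs with h
  · subst h
    simp [← dw_card_units]
  · have := MulChar.sum_eq_zero_of_ne_one h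
    rw [dw_sum_units, MulChar.map_zero, zero_add] at this
    exact this

lemma dw_exists_primitive : ∃ ψ : AddChar F ℂ, ψ.IsPrimitive := by
  obtain ⟨ψ, hψ⟩ := AddChar.exists_apply_ne_zero.2 (one_ne_zero (α := F))
  refine ⟨ψ, AddChar.IsPrimitive.of_ne_one ?_⟩
  rintro rfl
  simp at hψ

/-- Shifted four-variable Jacobi sum. -/
noncomputable def dwR (c1 c2 c3 c4 : MulChar F ℂ) (s : F) : ℂ :=
  ∑ y1 : F, ∑ y2 : F, ∑ y3 : F, ∑ y4 : F,
    if y1 + y2 + y3 + y4 = s then c1 y1 * c2 y2 * c3 y3 * c4 y4 else 0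

lemma dwR_scale (c1 c2 c3 c4 : MulChar F ℂ) (a : Fˣ) (s : F) :
    dwR c1 c2 c3 c4 (a * s) = (c1 * c2 * c3 * c4) (a : F) * dwR c1 c2 c3 c4 s := by
  have key : ∀ f : F → ℂ, ∑ y : F, f y = ∑ y : F, f (a * y) := fun f =>
    (Fintype.sum_equiv (Units.mulLeft a) _ _ (fun _ => rfl)).symm
  unfold dwR
  simp only [Finset.mul_sum]
  rw [key]
  refine Finset.sum_congr rfl fun y1 _ => ?_
  rw [key]
  refine Finset.sum_congr rfl fun y2 _ => ?_
  rw [key]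
  refine Finset.sum_congr rfl fun y3 _ => ?_
  rw [key]
  refine Finset.sum_congr rfl fun y4 _ => ?_
  simp only [← mul_add, map_mul, MulChar.mul_apply]
  rw [mul_right_inj' a.ne_zero]
  split_ifs <;> ring

lemma dwR_sum (c1 c2 c3 c4 : MulChar F ℂ) (f : F → ℂ) :
    ∑ s : F, f s * dwR c1 c2 c3 c4 s =
    ∑ y1 : F, ∑ y2 : F, ∑ y3 : F, ∑ y4 : F,
      c1 y1 * c2 y2 * c3 y3 * c4 y4 * f (y1 + y2 + y3 + y4) := by
  unfold dwR
  simp only [Finset.mul_sum]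
  rw [Finset.sum_comm]
  refine Finset.sum_congr rfl fun y1 _ => ?_
  rw [Finset.sum_comm]
  refine Finset.sum_congr rfl fun y2 _ => ?_
  rw [Finset.sum_comm]
  refine Finset.sum_congr rfl fun y3 _ => ?_
  rw [Finset.sum_comm]
  refine Finset.sum_congr rfl fun y4 _ => ?_
  simp [mul_comm]

lemma dw_prod4 (f1 f2 f3 f4 : F → ℂ) :
    ∑ y1 : F, ∑ y2 : F, ∑ y3 : F, ∑ y4 : F, f1 y1 * f2 y2 * f3 y3 * f4 y4 =
    (∑ y, f1 y) * (∑ y, f2 y) * (∑ y, f3 y) * (∑ y, f4 y) := by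
  simp only [← Finset.mul_sum, ← Finset.sum_mul]

lemma dwR_gauss (ψ : AddChar F ℂ) (c1 c2 c3 c4 : MulChar F ℂ) :
    ∑ s : F, ψ s * dwR c1 c2 c3 c4 s =
      gaussSum c1 ψ * gaussSum c2 ψ * gaussSum c3 ψ * gaussSum c4 ψ := by
  rw [dwR_sum]
  unfold gaussSum
  rw [← dw_prod4]
  refine Finset.sum_congr rfl fun y1 _ => Finset.sum_congr rfl fun y2 _ =>
    Finset.sum_congr rfl fun y3 _ => Finset.sum_congr rfl fun y4 _ => ?_
  simp only [AddChar.map_add_eq_mul]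
  ring

lemma dw_gauss_one (ψ : AddChar F ℂ) (hψ : ψ.IsPrimitive) :
    gaussSum (1 : MulChar F ℂ) ψ = -1 := by
  refine gaussSum_one_left (fun h => ?_)
  have h1 := hψ (one_ne_zero (α := F))
  apply h1
  rw [h]; ext x; simp

lemma dwR_of_ne {ψ : AddChar F ℂ} (c1 c2 c3 c4 : MulChar F ℂ)
    (h : c1 * c2 * c3 * c4 ≠ 1) :
    dwR c1 c2 c3 c4 1 * gaussSum (c1 * c2 * c3 * c4) ψ =
      gaussSum c1 ψ * gaussSum c2 ψ * gaussSum c3 ψ * gaussSum c4 ψ := by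
  have h0 : dwR c1 c2 c3 c4 0 = 0 := by
    obtain ⟨a, ha⟩ := MulChar.ne_one_iff.mp h
    have := dwR_scale c1 c2 c3 c4 a 0
    rw [mul_zero] at this
    have h2 : ((c1 * c2 * c3 * c4) (a : F) - 1) * dwR c1 c2 c3 c4 0 = 0 := by
      rw [sub_mul, ← this]; ring
    rcases mul_eq_zero.mp h2 with h3 | h3
    · exact absurd (sub_eq_zero.mp h3) ha
    · exact h3
  rw [← dwR_gauss, dw_sum_units, h0, mul_zero, zero_add]
  have : ∀ x : Fˣ, dwR c1 c2 c3 c4 x = (c1 * c2 * c3 * c4) (x : F) * dwR c1 c2 c3 c4 1 := by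
    intro x
    rw [← dwR_scale, mul_one]
  simp only [this]
  unfold gaussSum
  rw [dw_sum_units]
  simp only [MulChar.map_zero, zero_mul, zero_add, Finset.mul_sum]
  exact Finset.sum_congr rfl fun x _ => by ring

lemma dwR_of_eq {ψ : AddChar F ℂ} (hψ : ψ.IsPrimitive) (c1 c2 c3 c4 : MulChar F ℂ)
    (h : c1 * c2 * c3 * c4 = 1) :
    dwR c1 c2 c3 c4 1 * (Fintype.card F : ℂ) =
      (if c1 = 1 ∧ c2 = 1 ∧ c3 = 1 ∧ c4 = 1 then ((Fintype.card F : ℂ) - 1) ^ 4 else 0) -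
      gaussSum c1 ψ * gaussSum c2 ψ * gaussSum c3 ψ * gaussSum c4 ψ := by
  have hx : ∀ x : Fˣ, dwR c1 c2 c3 c4 x = dwR c1 c2 c3 c4 1 := by
    intro x
    have := dwR_scale c1 c2 c3 c4 x 1
    rw [h] at this
    simpa using this
  have h1 := dwR_gauss ψ c1 c2 c3 c4
  have h2 := dwR_sum c1 c2 c3 c4 (fun _ => 1)
  simp only [mul_one, one_mul] at h2
  rw [dw_prod4] at h2
  rw [dw_sum_units] at h1 h2
  simp only [hx, ← Finset.sum_mul] at h1 h2
  have h3 : ∑ x : Fˣ, ψ (x : F) = -1 := by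
    have := dw_gauss_one ψ hψ
    unfold gaussSum at this
    rw [dw_sum_units, MulChar.map_zero, zero_mul, zero_add] at this
    simpa using this
  rw [h3] at h1
  have hS : ∀ c : MulChar F ℂ, ∑ y : F, c y = if c = 1 then (Fintype.card F : ℂ) - 1 else 0 := by
    intro c
    rw [dw_sum_units, dw_sum_char_units, MulChar.map_zero, zero_add]
  simp only [hS] at h2
  simp only [Finset.sum_const, Finset.card_univ, nsmul_eq_mul, dw_card_units] at h2
  have h4 : (if c1 = 1 ∧ c2 = 1 ∧ c3 = 1 ∧ c4 = 1 then ((Fintype.card F : ℂ) - 1) ^ 4 else 0)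
      = ((if c1 = 1 then (Fintype.card F : ℂ) - 1 else 0) *
      (if c2 = 1 then (Fintype.card F : ℂ) - 1 else 0) *
      (if c3 = 1 then (Fintype.card F : ℂ) - 1 else 0) *
      (if c4 = 1 then (Fintype.card F : ℂ) - 1 else 0)) := by
    by_cases h1 : c1 = 1 <;> by_cases h2 : c2 = 1 <;> by_cases h3 : c3 = 1 <;>
      by_cases h4 : c4 = 1 <;> simp [h1, h2, h3, h4]
    ring
  rw [h4, ← h1, ← h2]
  simp
  ring

lemma dw_gauss_ne_zero {ψ : AddChar F ℂ} (hψ : ψ.IsPrimitive) (A : MulChar F ℂ) :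
    gaussSum A ψ ≠ 0 := by
  by_cases h : A = 1
  · subst h; rw [dw_gauss_one ψ hψ]; simp
  · exact gaussSum_ne_zero_of_nontrivial dw_card_ne_zero h hψ

lemma dw_neg_one_sq (A : MulChar F ℂ) : A (-1) * A (-1) = 1 := by
  rw [← map_mul]; simp

lemma dw_inv_neg_one (A : MulChar F ℂ) : A⁻¹ (-1) = A (-1) := by
  have h3 : A (-1) * A⁻¹ (-1) = 1 := by
    rw [← MulChar.mul_apply, mul_inv_cancel, MulChar.one_apply (by simp)]
  linear_combination A (-1) * h3 - A⁻¹ (-1) * dw_neg_one_sq A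

lemma dw_gauss_inv {ψ : AddChar F ℂ} (hψ : ψ.IsPrimitive) (A : MulChar F ℂ) (h : A ≠ 1) :
    gaussSum A ψ * gaussSum A⁻¹ ψ = A (-1) * (Fintype.card F : ℂ) := by
  have h1 := gaussSum_mul_gaussSum_eq_card h hψ
  have h2 := mul_gaussSum_inv_eq_gaussSum A⁻¹ ψ
  rw [← h1, ← h2, dw_inv_neg_one]
  ring

lemma dw_jac {ψ : AddChar F ℂ} (A B : MulChar F ℂ) (h : A * B ≠ 1) :
    jacobiSum A B * gaussSum (A * B) ψ = gaussSum A ψ * gaussSum B ψ := by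
  rw [← jacobiSum_mul_nontrivial h]; ring

end DworkHelpers


set_option linter.unusedSectionVars false

section DworkHelpersB

variable {F : Type} [Field F] [Fintype F]

lemma dw_root_count (n : ℕ) (u : Fˣ) :
    ∑ A ∈ Finset.univ.filter (fun A : MulChar F ℂ => A ^ n = 1), A (u : F) =
      ∑ x : Fˣ, if x ^ n = u then (1 : ℂ) else 0 := by
  have hq := dw_card_sub_one_ne_zero (F := F)
  apply mul_left_cancel₀ hq
  rw [Finset.sum_filter, Finset.mul_sum, Finset.mul_sum]
  have h1 : ∀ A : MulChar F ℂ, ((Fintype.card F : ℂ) - 1) * (if A ^ n = 1 then A (u : F) else 0)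
      = ∑ x : Fˣ, A ((u * (x ^ n)⁻¹ : Fˣ) : F) := by
    intro A
    have h2 := dw_sum_char_units (A ^ n)
    have h3 : ∑ x : Fˣ, (A ^ n) ((x⁻¹ : Fˣ) : F) = ∑ x : Fˣ, (A ^ n) (x : F) :=
      Fintype.sum_equiv (Equiv.inv Fˣ) _ _ (fun _ => rfl)
    have h4 : ∀ x : Fˣ, A ((u * (x ^ n)⁻¹ : Fˣ) : F) = A (u : F) * (A ^ n) ((x⁻¹ : Fˣ) : F) := by
      intro x
      rw [← inv_pow, Units.val_mul, map_mul, Units.val_pow_eq_pow_val, map_pow,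
        MulChar.pow_apply_coe]
    simp only [h4]
    rw [← Finset.mul_sum, h3, h2]
    split_ifs <;> ring
  simp only [h1]
  rw [Finset.sum_comm]
  refine Finset.sum_congr rfl fun x _ => ?_
  rw [dw_orth]
  by_cases h : x ^ n = u
  · simp [h]
  · rw [if_neg, if_neg h, mul_zero]
    intro h'
    apply h
    rw [mul_inv_eq_one] at h'
    exact h'.symm

lemma dw_pow_sum (n : ℕ) (h : Fˣ → ℂ) :
    ∑ x : Fˣ, h (x ^ n) =
      ∑ u : Fˣ, (∑ A ∈ Finset.univ.filter (fun A : MulChar F ℂ => A ^ n = 1), A (u : F)) * h u := by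
  simp only [dw_root_count, Finset.sum_mul]
  rw [Finset.sum_comm]
  refine Finset.sum_congr rfl fun x _ => ?_
  simp

/-- Working hypotheses on the quartic character. -/
structure DwQ (T : MulChar F ℂ) : Prop where
  two : (2 : F) ≠ 0
  t4 : T ^ 4 = 1
  t2 : T ^ 2 ≠ 1
  all : ∀ A : MulChar F ℂ, A ^ 4 = 1 → A = 1 ∨ A = T ∨ A = T ^ 2 ∨ A = T ^ 3

variable {T : MulChar F ℂ}

lemma DwQ.t1 (h : DwQ T) : T ≠ 1 := fun h1 => h.t2 (by rw [h1]; simp)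
lemma DwQ.t3 (h : DwQ T) : T ^ 3 ≠ 1 := fun h1 => h.t1 (by
  have := h.t4; rw [pow_succ, h1, one_mul] at this; exact this)
lemma DwQ.t12 (h : DwQ T) : T ≠ T ^ 2 := fun h1 => h.t1 (by
  rw [pow_two] at h1; exact (mul_eq_left.mp h1.symm))
lemma DwQ.t13 (h : DwQ T) : T ≠ T ^ 3 := fun h1 => h.t2 (by
  rw [pow_succ'] at h1; exact (mul_eq_left.mp h1.symm))
lemma DwQ.t23 (h : DwQ T) : T ^ 2 ≠ T ^ 3 := fun h1 => h.t1 (by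
  rw [pow_succ T 2] at h1; exact (mul_eq_left.mp h1.symm))
lemma DwQ.inv1 (h : DwQ T) : T⁻¹ = T ^ 3 := by
  rw [inv_eq_iff_mul_eq_one, ← pow_succ', h.t4]
lemma DwQ.inv2 (h : DwQ T) : (T ^ 2)⁻¹ = T ^ 2 := by
  rw [inv_eq_iff_mul_eq_one, ← pow_add, h.t4]
lemma DwQ.inv3 (h : DwQ T) : (T ^ 3)⁻¹ = T := by
  rw [inv_eq_iff_mul_eq_one, ← pow_succ, h.t4]
lemma DwQ.t6 (h : DwQ T) : (T ^ 3) ^ 2 = T ^ 2 := by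
  rw [← pow_mul, show 3 * 2 = 4 + 2 from rfl, pow_add, h.t4, one_mul]

lemma DwQ.filter2 (h : DwQ T) :
    Finset.univ.filter (fun A : MulChar F ℂ => A ^ 2 = 1) = {1, T ^ 2} := by
  ext A
  simp only [Finset.mem_filter, Finset.mem_univ, true_and, Finset.mem_insert,
    Finset.mem_singleton]
  constructor
  · intro hA
    rcases h.all A (by rw [show 4 = 2 * 2 from rfl, pow_mul, hA, one_pow]) with h1 | h1 | h1 | h1
    · exact Or.inl h1
    · exact absurd (h1 ▸ hA) h.t2
    · exact Or.inr h1
    · rw [h1, h.t6] at hA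
      exact absurd hA h.t2
  · rintro (h1 | h1)
    · rw [h1, one_pow]
    · rw [h1, ← pow_mul, h.t4]

lemma DwQ.filter4 (h : DwQ T) :
    Finset.univ.filter (fun A : MulChar F ℂ => A ^ 4 = 1) = {1, T, T ^ 2, T ^ 3} := by
  ext A
  simp only [Finset.mem_filter, Finset.mem_univ, true_and, Finset.mem_insert,
    Finset.mem_singleton]
  constructor
  · exact h.all A
  · rintro (h1 | h1 | h1 | h1) <;> rw [h1]
    · rw [one_pow]
    · exact h.t4
    · rw [← pow_mul, mul_comm, pow_mul, h.t4, one_pow]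
    · rw [← pow_mul, mul_comm, pow_mul, h.t4, one_pow]

lemma DwQ.sq_sum (hT : DwQ T) (h : Fˣ → ℂ) :
    ∑ x : Fˣ, h (x ^ 2) = ∑ u : Fˣ, (1 + (T ^ 2) (u : F)) * h u := by
  rw [dw_pow_sum, hT.filter2]
  refine Finset.sum_congr rfl fun u _ => ?_
  rw [Finset.sum_pair hT.t2.symm]
  simp

lemma DwQ.fourth_sum (hT : DwQ T) (h : Fˣ → ℂ) :
    ∑ x : Fˣ, h (x ^ 4) = ∑ a ∈ Finset.range 4, ∑ u : Fˣ, (T ^ a) (u : F) * h u := by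
  rw [dw_pow_sum, hT.filter4, Finset.sum_comm]
  refine Finset.sum_congr rfl fun u _ => ?_
  rw [← Finset.sum_mul]
  congr 1
  rw [Finset.sum_insert, Finset.sum_insert, Finset.sum_pair hT.t23]
  · simp [Finset.sum_range_succ]; ring
  · simp [hT.t12, hT.t13]
  · simp [hT.t1.symm, hT.t2.symm, hT.t3.symm]

lemma DwQ.jac_self (hT : DwQ T) (A : MulChar F ℂ) (hA : A ≠ 1) :
    A 4 * jacobiSum A A = jacobiSum (T ^ 2) A := by
  have h2 := hT.two
  have h4 : (4 : F) ≠ 0 := by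
    rw [show (4 : F) = 2 * 2 by norm_num]; exact mul_ne_zero h2 h2
  unfold jacobiSum
  have h1 : ∑ x : F, A x * A (1 - x) = ∑ w : F, A ((1 + w) / 2) * A (1 - (1 + w) / 2) :=
    (Fintype.sum_equiv (⟨fun w => (1 + w) / 2, fun x => 2 * x - 1,
      fun w => by field_simp; ring, fun x => by field_simp; ring⟩ : F ≃ F) _ _ (fun _ => rfl)).symm
  rw [h1, Finset.mul_sum]
  have h3 : ∀ w : F, A 4 * (A ((1 + w) / 2) * A (1 - (1 + w) / 2)) = A (1 - w ^ 2) := by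
    intro w
    rw [← map_mul, ← map_mul]
    congr 1
    field_simp
    ring
  simp only [h3]
  rw [dw_sum_units]
  have h5 := hT.sq_sum (fun u => A (1 - (u : F)))
  simp only [Units.val_pow_eq_pow_val] at h5
  rw [h5]
  simp only [add_mul, one_mul, Finset.sum_add_distrib]
  have h6 : ∑ u : F, A (1 - u) = 0 := by
    rw [← MulChar.sum_eq_zero_of_ne_one hA]
    exact Fintype.sum_equiv (Equiv.subLeft 1) _ _ (fun _ => rfl)
  rw [dw_sum_units] at h6
  rw [dw_sum_units (fun x => (T ^ 2) x * A (1 - x))]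
  simp only [MulChar.map_zero]
  simp at h6 ⊢
  linear_combination h6

/-- Hasse-Davenport for m = 2. -/
lemma DwQ.hd2 (hT : DwQ T) {ψ : AddChar F ℂ} (hψ : ψ.IsPrimitive) (A : MulChar F ℂ) :
    A 4 * (gaussSum A ψ * gaussSum (A * T ^ 2) ψ) = gaussSum (A ^ 2) ψ * gaussSum (T ^ 2) ψ := by
  by_cases h : A ^ 2 = 1
  · have hm : A ∈ Finset.univ.filter (fun A : MulChar F ℂ => A ^ 2 = 1) := by simp [h]
    have h2 := hT.two
    have h4 : (4 : F) ≠ 0 := by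
      rw [show (4 : F) = 2 * 2 by norm_num]; exact mul_ne_zero h2 h2
    rw [hT.filter2] at hm
    simp only [Finset.mem_insert, Finset.mem_singleton] at hm
    rcases hm with rfl | rfl
    · rw [one_mul, one_pow, MulChar.one_apply h4.isUnit]; ring
    · have h5 : (T ^ 2) 4 = 1 := by
        rw [show (4 : F) = (2 : F) ^ 2 by norm_num, map_pow]
        have := MulChar.pow_apply' (T ^ 2) two_ne_zero 2
        rw [← this, ← pow_mul, hT.t4, MulChar.one_apply h2.isUnit]
      rw [h5, h, ← pow_add, hT.t4]; ring
  · have hA : A ≠ 1 := fun h1 => h (by rw [h1, one_pow])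
    have hne : T ^ 2 * A ≠ 1 := by
      intro h1
      apply h
      have : A = (T ^ 2)⁻¹ := (eq_inv_of_mul_eq_one_right h1)
      rw [this, hT.inv2, ← pow_mul, hT.t4]
    have j1 := dw_jac (ψ := ψ) A A (by rw [← pow_two]; exact h)
    have j2 := dw_jac (ψ := ψ) (T ^ 2) A hne
    rw [← hT.jac_self A hA] at j2
    rw [← pow_two] at j1
    rw [mul_comm A (T ^ 2)]
    have g := dw_gauss_ne_zero hψ A
    apply mul_left_cancel₀ g
    linear_combination (-(A 4 * gaussSum (T ^ 2 * A) ψ)) * j1 + gaussSum (A ^ 2) ψ * j2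

/-- Hasse-Davenport for m = 4. -/
lemma DwQ.hd4 (hT : DwQ T) {ψ : AddChar F ℂ} (hψ : ψ.IsPrimitive) (A : MulChar F ℂ) :
    A 4 ^ 4 * (gaussSum A ψ * gaussSum (A * T) ψ * gaussSum (A * T ^ 2) ψ *
      gaussSum (A * T ^ 3) ψ) =
    gaussSum (A ^ 4) ψ * (gaussSum T ψ * gaussSum (T ^ 2) ψ * gaussSum (T ^ 3) ψ) := by
  have h2 := hT.two
  have h4 : (4 : F) ≠ 0 := by
    rw [show (4 : F) = 2 * 2 by norm_num]; exact mul_ne_zero h2 h2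
  have g := dw_gauss_ne_zero hψ (T ^ 2)
  have hT4 : T 4 ≠ 0 := by
    have := h4.isUnit.map T
    exact this.ne_zero
  have key : ∀ A : MulChar F ℂ, A 4 ^ 4 * T 4 * (gaussSum A ψ * gaussSum (A * T) ψ *
      gaussSum (A * T ^ 2) ψ *
      gaussSum (A * T ^ 3) ψ) = gaussSum (A ^ 4) ψ * gaussSum (T ^ 2) ψ ^ 3 := by
    intro A
    have a1 := hT.hd2 hψ A
    have a2 := hT.hd2 hψ (A * T)
    have a3 := hT.hd2 hψ (A ^ 2)
    rw [show A * T * T ^ 2 = A * T ^ 3 by rw [mul_assoc, ← pow_succ'], mul_pow,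
      MulChar.mul_apply] at a2
    rw [← pow_mul] at a3
    rw [MulChar.pow_apply' _ two_ne_zero] at a3
    calc _ = (A 4 * (gaussSum A ψ * gaussSum (A * T ^ 2) ψ)) *
          (A 4 * T 4 * (gaussSum (A * T) ψ * gaussSum (A * T ^ 3) ψ)) * A 4 ^ 2 := by ring
      _ = (A 4 ^ 2 * (gaussSum (A ^ 2) ψ * gaussSum (A ^ 2 * T ^ 2) ψ)) *
            gaussSum (T ^ 2) ψ ^ 2 := by rw [a1, a2]; ring
      _ = _ := by rw [a3]; ring
  have k1 := key 1
  have kA := key A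
  simp only [one_mul, one_pow, dw_gauss_one ψ hψ, MulChar.one_apply h4.isUnit] at k1
  apply mul_left_cancel₀ hT4
  linear_combination kA + gaussSum (A ^ 4) ψ * k1

end DworkHelpersB

set_option linter.unusedSectionVars false

section DworkHelpersC

variable {F : Type} [Field F] [Fintype F]

/-- The normalising factor in the four-variable Jacobi sum. -/
noncomputable def dwK (ψ : AddChar F ℂ) (A : MulChar F ℂ) : ℂ :=
  if A ^ 4 = 1 then -1 / (Fintype.card F : ℂ) else (gaussSum (A ^ 4) ψ)⁻¹

/-- The Mellin-type sum of products of four Gauss sums. -/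
noncomputable def dwP (T : MulChar F ℂ) (ψ : AddChar F ℂ) (c : F) (i j k l : ℕ) : ℂ :=
  ∑ A : MulChar F ℂ, A (c ^ 4) * dwK ψ A *
    (gaussSum (A * T ^ i) ψ * gaussSum (A * T ^ j) ψ * gaussSum (A * T ^ k) ψ *
      gaussSum (A * T ^ l) ψ)

variable {T : MulChar F ℂ} {ψ : AddChar F ℂ}

lemma DwQ.T_pow4 (hT : DwQ T) (x : Fˣ) : T ((x : F) ^ 4) = 1 := by
  rw [map_pow, ← MulChar.pow_apply_coe, hT.t4, MulChar.one_apply_coe]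

lemma DwQ.P_shift (hT : DwQ T) (c : Fˣ) (i j k l : ℕ) :
    dwP T ψ c i j k l = dwP T ψ c (i + 1) (j + 1) (k + 1) (l + 1) := by
  unfold dwP
  refine (Fintype.sum_equiv (Equiv.mulRight T) _ _ (fun A => ?_)).symm
  simp only [Equiv.coe_mulRight]
  have h1 : ∀ i, A * T * T ^ i = A * T ^ (i + 1) := by
    intro i; rw [mul_assoc, ← pow_succ']
  have h2 : dwK ψ (A * T) = dwK ψ A := by
    unfold dwK; rw [mul_pow, hT.t4, mul_one]
  rw [h1, h1, h1, h1, h2, MulChar.mul_apply, hT.T_pow4, mul_one]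

lemma dwP_swap12 (c : F) (i j k l : ℕ) : dwP T ψ c i j k l = dwP T ψ c j i k l := by
  unfold dwP
  exact Finset.sum_congr rfl fun A _ => by ring
lemma dwP_swap23 (c : F) (i j k l : ℕ) : dwP T ψ c i j k l = dwP T ψ c i k j l := by
  unfold dwP
  exact Finset.sum_congr rfl fun A _ => by ring
lemma dwP_swap34 (c : F) (i j k l : ℕ) : dwP T ψ c i j k l = dwP T ψ c i j l k := by
  unfold dwP
  exact Finset.sum_congr rfl fun A _ => by ring
lemma DwQ.P_red (hT : DwQ T) (c : F) (i j k l : ℕ) :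
    dwP T ψ c (i + 4) j k l = dwP T ψ c i j k l := by
  unfold dwP
  rw [pow_add, hT.t4, mul_one]

lemma dw_R_eq_P (hψ : ψ.IsPrimitive) (c : Fˣ) (i j l : ℕ)
    (h : T ^ (i + j + l) = 1) :
    ∑ A : MulChar F ℂ, A ((c : F) ^ 4) * dwR (A * T ^ i) (A * T ^ j) A (A * T ^ l) 1 =
      dwP T ψ c i j 0 l + if T ^ i = 1 ∧ T ^ j = 1 ∧ T ^ l = 1 then
        ((Fintype.card F : ℂ) - 1) ^ 4 / (Fintype.card F : ℂ) else 0 := by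
  have hq := dw_card_ne_zero (F := F)
  have hprod : ∀ A : MulChar F ℂ, (A * T ^ i) * (A * T ^ j) * A * (A * T ^ l) = A ^ 4 := by
    intro A
    calc _ = A ^ 4 * T ^ (i + j + l) := by
          rw [pow_add, pow_add]; 
          simp only [pow_succ, pow_zero, one_mul]
          ac_rfl
      _ = _ := by rw [h, mul_one]
  have hterm : ∀ A : MulChar F ℂ,
      A ((c : F) ^ 4) * dwR (A * T ^ i) (A * T ^ j) A (A * T ^ l) 1 =
      A ((c : F) ^ 4) * dwK ψ A *
    (gaussSum (A * T ^ i) ψ * gaussSum (A * T ^ j) ψ * gaussSum (A * T ^ 0) ψ *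
      gaussSum (A * T ^ l) ψ) + if A = 1 then (if T ^ i = 1 ∧ T ^ j = 1 ∧ T ^ l = 1 then
        ((Fintype.card F : ℂ) - 1) ^ 4 / (Fintype.card F : ℂ) else 0) else 0 := by
    intro A
    rw [pow_zero, mul_one]
    by_cases h4 : A ^ 4 = 1
    · have hR := dwR_of_eq hψ (A * T ^ i) (A * T ^ j) A (A * T ^ l) ((hprod A).trans h4)
      have hR' := eq_div_of_mul_eq hq hR
      rw [hR']
      unfold dwK
      rw [if_pos h4]
      by_cases hA : A = 1
      · subst hA
        simp only [one_mul, true_and, if_true]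
        have : (1 : MulChar F ℂ) ((c : F) ^ 4) = 1 := MulChar.one_apply (c.isUnit.pow 4)
        rw [this]
        split_ifs <;> ring
      · rw [if_neg (fun hh => hA hh.2.2.1), if_neg hA]
        ring
    · have hR := dwR_of_ne (ψ := ψ) (A * T ^ i) (A * T ^ j) A (A * T ^ l)
        (by rw [hprod]; exact h4)
      rw [hprod] at hR
      have hR' := eq_div_of_mul_eq (dw_gauss_ne_zero hψ _) hR
      have hA : A ≠ 1 := fun hh => h4 (by rw [hh, one_pow])
      rw [hR', if_neg hA]
      unfold dwK
      rw [if_neg h4]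
      ring
  simp only [hterm, Finset.sum_add_distrib]
  rw [Finset.sum_ite_eq' Finset.univ (1 : MulChar F ℂ), if_pos (Finset.mem_univ _)]
  rfl

lemma dw_P0 (hψ : ψ.IsPrimitive) (c : Fˣ) :
    dwP T ψ c 0 0 0 0 =
      ∑ A : MulChar F ℂ, A (-1) * A ((c : F) ^ 4) * gaussSum (A⁻¹ ^ 4) ψ * gaussSum A ψ ^ 3 /
        gaussSum A⁻¹ ψ + (1 - 1 / (Fintype.card F : ℂ)) := by
  have hq := dw_card_ne_zero (F := F)
  have hterm : ∀ A : MulChar F ℂ, A ((c : F) ^ 4) * dwK ψ A *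
    (gaussSum (A * T ^ 0) ψ * gaussSum (A * T ^ 0) ψ * gaussSum (A * T ^ 0) ψ *
      gaussSum (A * T ^ 0) ψ) = A (-1) * A ((c : F) ^ 4) * gaussSum (A⁻¹ ^ 4) ψ *
        gaussSum A ψ ^ 3 / gaussSum A⁻¹ ψ +
        if A = 1 then (1 - 1 / (Fintype.card F : ℂ)) else 0 := by
    intro A
    rw [pow_zero, mul_one]
    unfold dwK
    by_cases hA : A = 1
    · subst hA
      have : (1 : MulChar F ℂ) ((c : F) ^ 4) = 1 := MulChar.one_apply (c.isUnit.pow 4)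
      have h' : (1 : MulChar F ℂ) (-1) = 1 := MulChar.one_apply (by simp)
      simp only [one_pow, inv_one, if_true, dw_gauss_one ψ hψ, this, h']
      field_simp
      ring
    · rw [if_neg hA]
      have g := dw_gauss_inv hψ A hA
      have m := dw_neg_one_sq A
      have n0 := dw_gauss_ne_zero hψ A
      have n1 := dw_gauss_ne_zero hψ A⁻¹
      by_cases h4 : A ^ 4 = 1
      · rw [if_pos h4, inv_pow, h4, inv_one, dw_gauss_one ψ hψ]
        field_simp
        linear_combination (-A ((c : F) ^ 4) * gaussSum A ψ ^ 3) * g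
      · rw [if_neg h4, inv_pow]
        have g' := dw_gauss_inv hψ (A ^ 4) h4
        have n4 := dw_gauss_ne_zero hψ (A ^ 4)
        have e4 : (A ^ 4) (-1) = 1 := by
          rw [MulChar.pow_apply' _ (by norm_num)]
          linear_combination (A (-1) * A (-1) + 1) * m
        rw [e4, one_mul] at g'
        field_simp
        linear_combination (A ((c : F) ^ 4) * gaussSum A ψ ^ 3) * g - A ((c : F) ^ 4) * gaussSum A ψ ^ 3 * A (-1) * g'
  unfold dwP
  simp only [hterm, Finset.sum_add_distrib]
  rw [Finset.sum_ite_eq' Finset.univ (1 : MulChar F ℂ), if_pos (Finset.mem_univ _)]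

section
lemma DwQ.m11 (hT : DwQ T) : T * T = T ^ 2 := (pow_two T).symm
lemma DwQ.m12 (hT : DwQ T) : T * T ^ 2 = T ^ 3 := (pow_succ' T 2).symm
lemma DwQ.m13 (hT : DwQ T) : T * T ^ 3 = 1 := by rw [← pow_succ', hT.t4]
lemma DwQ.m21 (hT : DwQ T) : T ^ 2 * T = T ^ 3 := (pow_succ T 2).symm
lemma DwQ.m22 (hT : DwQ T) : T ^ 2 * T ^ 2 = 1 := by rw [← pow_add, hT.t4]
lemma DwQ.m23 (hT : DwQ T) : T ^ 2 * T ^ 3 = T := by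
  rw [← pow_add, show 2 + 3 = 4 + 1 from rfl, pow_succ, hT.t4, one_mul]
lemma DwQ.m31 (hT : DwQ T) : T ^ 3 * T = 1 := by rw [← pow_succ, hT.t4]
lemma DwQ.m32 (hT : DwQ T) : T ^ 3 * T ^ 2 = T := by rw [mul_comm, hT.m23]
lemma DwQ.m33 (hT : DwQ T) : T ^ 3 * T ^ 3 = T ^ 2 := by rw [← pow_two, hT.t6]
lemma DwQ.s2 (hT : DwQ T) : (T ^ 2) (-1) = 1 := by
  rw [MulChar.pow_apply' _ two_ne_zero, pow_two, dw_neg_one_sq]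
lemma DwQ.s3 (hT : DwQ T) : (T ^ 3) (-1) = T (-1) := by
  rw [MulChar.pow_apply' _ (by norm_num), pow_succ, pow_two, dw_neg_one_sq, one_mul]
lemma DwQ.g13 (hT : DwQ T) (hψ : ψ.IsPrimitive) :
    gaussSum T ψ * gaussSum (T ^ 3) ψ = T (-1) * (Fintype.card F : ℂ) := by
  rw [← dw_gauss_inv hψ T hT.t1, hT.inv1]
lemma DwQ.g22 (hT : DwQ T) (hψ : ψ.IsPrimitive) :
    gaussSum (T ^ 2) ψ * gaussSum (T ^ 2) ψ = (Fintype.card F : ℂ) := by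
  have := dw_gauss_inv hψ (T ^ 2) hT.t2
  rwa [hT.inv2, hT.s2, one_mul] at this
lemma DwQ.pow4_one (hT : DwQ T) (A : MulChar F ℂ) (hA : A ^ 4 = 1) (x : Fˣ) : A ((x : F) ^ 4) = 1 := by
  rw [map_pow, ← MulChar.pow_apply_coe, hA, MulChar.one_apply_coe]

lemma DwQ.P13 (hT : DwQ T) (hψ : ψ.IsPrimitive) (lam c : Fˣ) (hc : (c : F) = 4 * lam) :
    dwP T ψ c 0 0 1 3 =
      ∑ A : MulChar F ℂ, T (-1) * (Fintype.card F : ℂ) * (A ((lam : F) ^ 4) * jacobiSum (T ^ 2) A)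
      + ((Fintype.card F : ℂ) - 1) * (T (-1) - jacobiSum T T - jacobiSum (T ^ 3) (T ^ 3)) := by
  have hq := dw_card_ne_zero (F := F)
  have g13 := hT.g13 hψ
  have g22 := hT.g22 hψ
  have ss := dw_neg_one_sq T
  have n1 := dw_gauss_ne_zero hψ T
  have n2 := dw_gauss_ne_zero hψ (T ^ 2)
  have n3 := dw_gauss_ne_zero hψ (T ^ 3)
  have j11 := dw_jac (ψ := ψ) T T (by rw [hT.m11]; exact hT.t2)
  rw [hT.m11] at j11
  have j33 := dw_jac (ψ := ψ) (T ^ 3) (T ^ 3) (by rw [hT.m33]; exact hT.t2)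
  rw [hT.m33] at j33
  have hterm : ∀ A : MulChar F ℂ, A ((c : F) ^ 4) * dwK ψ A *
    (gaussSum (A * T ^ 0) ψ * gaussSum (A * T ^ 0) ψ * gaussSum (A * T ^ 1) ψ *
      gaussSum (A * T ^ 3) ψ) =
      T (-1) * (Fintype.card F : ℂ) * (A ((lam : F) ^ 4) * jacobiSum (T ^ 2) A) +
      ((if A = 1 then ((Fintype.card F : ℂ) - 1) * T (-1) else 0) +
       (if A = T then -((Fintype.card F : ℂ) - 1) * jacobiSum T T else 0) +
       (if A = T ^ 3 then -((Fintype.card F : ℂ) - 1) * jacobiSum (T ^ 3) (T ^ 3) else 0)) := by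
    intro A
    rw [pow_zero, mul_one, pow_one]
    unfold dwK
    by_cases h4 : A ^ 4 = 1
    · rw [if_pos h4, hT.pow4_one A h4, hT.pow4_one A h4]
      rcases hT.all A h4 with hA | hA | hA | hA <;> rw [hA]
      · rw [if_pos rfl, if_neg hT.t1.symm, if_neg hT.t3.symm, one_mul T, one_mul (T ^ 3),
          dw_gauss_one ψ hψ, jacobiSum_comm, jacobiSum_one_nontrivial hT.t2]
        field_simp
        linear_combination -g13
      · rw [if_neg hT.t1, if_pos rfl, if_neg hT.t13, hT.m11, hT.m13, dw_gauss_one ψ hψ]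
        have j := dw_jac (ψ := ψ) (T ^ 2) T (by rw [hT.m21]; exact hT.t3)
        rw [hT.m21] at j
        have e1 := eq_div_of_mul_eq n3 j
        have e2 := eq_div_of_mul_eq n2 j11
        rw [e1, e2]
        field_simp
        have g13' : gaussSum (T ^ 3) ψ = T (-1) * (Fintype.card F : ℂ) / gaussSum T ψ := by
          rw [eq_div_iff n1]; linear_combination g13
        rw [g13']
        field_simp
        rw [show gaussSum (T ^ 2) ψ ^ 2 = (Fintype.card F : ℂ) by rw [pow_two, g22]]
        ring
      · rw [if_neg hT.t2, if_neg hT.t12.symm, if_neg hT.t23, hT.m21, hT.m23]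
        have j : jacobiSum (T ^ 2) (T ^ 2) = -1 := by
          have := jacobiSum_nontrivial_inv hT.t2
          rwa [hT.inv2, hT.s2] at this
        rw [j]
        have : gaussSum (T ^ 2) ψ * gaussSum (T ^ 2) ψ * gaussSum (T ^ 3) ψ * gaussSum T ψ
          = (Fintype.card F : ℂ) * (T (-1) * (Fintype.card F : ℂ)) := by
          rw [← g13, g22]; ring
        rw [this]
        field_simp
        ring
      · rw [if_neg hT.t3, if_neg hT.t13.symm, if_pos rfl, hT.m31, hT.m33, dw_gauss_one ψ hψ]
        have j := dw_jac (ψ := ψ) (T ^ 2) (T ^ 3) (by rw [hT.m23]; exact hT.t1)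
        rw [hT.m23] at j
        have e1 := eq_div_of_mul_eq n1 j
        have e2 := eq_div_of_mul_eq n2 j33
        rw [e1, e2]
        have g13' : gaussSum T ψ = T (-1) * (Fintype.card F : ℂ) / gaussSum (T ^ 3) ψ := by
          rw [eq_div_iff n3]; linear_combination g13
        have hs : T (-1) ≠ 0 := by
          intro h0; rw [h0] at ss; simp at ss
        rw [g13']
        field_simp
        rw [show gaussSum (T ^ 2) ψ ^ 2 = (Fintype.card F : ℂ) by rw [pow_two, g22]]
        ring
    · have hA1 : A ≠ 1 := by rintro rfl; simp at h4
      have hA2 : A ≠ T := by rintro rfl; exact h4 hT.t4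
      have hA3 : A ≠ T ^ 3 := by
        rintro rfl; apply h4; rw [← pow_mul, mul_comm, pow_mul, hT.t4, one_pow]
      have hA4 : T ^ 2 * A ≠ 1 := by
        intro h1
        apply h4
        have : A = (T ^ 2)⁻¹ := (eq_inv_of_mul_eq_one_right h1)
        rw [this, hT.inv2, ← pow_mul, mul_comm, pow_mul, hT.t4, one_pow]
      rw [if_neg h4, if_neg hA1, if_neg hA2, if_neg hA3]
      have hd := hT.hd4 hψ A
      have j := dw_jac (ψ := ψ) (T ^ 2) A hA4
      rw [mul_comm (T ^ 2) A] at j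
      have nb := dw_gauss_ne_zero hψ (A * T ^ 2)
      have n4 := dw_gauss_ne_zero hψ (A ^ 4)
      rw [hc, mul_pow, map_mul, map_pow A 4 4]
      field_simp
      apply mul_right_cancel₀ nb
      linear_combination (A ((lam : F) ^ 4) * gaussSum A ψ) * hd +
        A ((lam : F) ^ 4) * gaussSum A ψ * gaussSum (A ^ 4) ψ * gaussSum (T ^ 2) ψ * g13 -
        T (-1) * (Fintype.card F : ℂ) * A ((lam : F) ^ 4) * gaussSum (A ^ 4) ψ * j
  unfold dwP
  simp only [hterm, Finset.sum_add_distrib]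
  simp only [Finset.sum_ite_eq', Finset.mem_univ, if_true]
  ring

lemma DwQ.P2 (hT : DwQ T) (hψ : ψ.IsPrimitive) (lam c : Fˣ) (hc : (c : F) = 4 * lam) :
    dwP T ψ c 0 0 2 2 =
      ∑ A : MulChar F ℂ, A ((lam : F) ^ 4) * (jacobiSum (T ^ 3) (T ^ 3) * jacobiSum T A *
        jacobiSum (T * A⁻¹) T)
      + 2 * ((Fintype.card F : ℂ) - 1) := by
  have hq := dw_card_ne_zero (F := F)
  have g13 := hT.g13 hψ
  have g22 := hT.g22 hψ
  have ss := dw_neg_one_sq T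
  have n1 := dw_gauss_ne_zero hψ T
  have n2 := dw_gauss_ne_zero hψ (T ^ 2)
  have n3 := dw_gauss_ne_zero hψ (T ^ 3)
  have j11 := dw_jac (ψ := ψ) T T (by rw [hT.m11]; exact hT.t2)
  rw [hT.m11] at j11
  have j33 := dw_jac (ψ := ψ) (T ^ 3) (T ^ 3) (by rw [hT.m33]; exact hT.t2)
  rw [hT.m33] at j33
  have e11 := eq_div_of_mul_eq n2 j11
  have e33 := eq_div_of_mul_eq n2 j33
  have j1133 : jacobiSum (T ^ 3) (T ^ 3) * jacobiSum T T = (Fintype.card F : ℂ) := by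
    apply mul_right_cancel₀ (mul_ne_zero n2 n2)
    calc _ = (jacobiSum (T ^ 3) (T ^ 3) * gaussSum (T ^ 2) ψ) *
              (jacobiSum T T * gaussSum (T ^ 2) ψ) := by ring
      _ = (gaussSum T ψ * gaussSum (T ^ 3) ψ) * (gaussSum T ψ * gaussSum (T ^ 3) ψ) := by
          rw [j11, j33]; ring
      _ = _ := by
          rw [g13, g22]; linear_combination (Fintype.card F : ℂ) ^ 2 * ss
  have jT : jacobiSum T (T ^ 3) = - T (-1) := by
    have := jacobiSum_nontrivial_inv hT.t1
    rwa [hT.inv1] at this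
  have j32 : jacobiSum (T ^ 3) (T ^ 3) * jacobiSum T (T ^ 2) = T (-1) * (Fintype.card F : ℂ) := by
    have j12 := dw_jac (ψ := ψ) T (T ^ 2) (by rw [hT.m12]; exact hT.t3)
    rw [hT.m12] at j12
    have := eq_div_of_mul_eq n3 j12
    rw [e33, this, ← g13]
    field_simp
  have hterm : ∀ A : MulChar F ℂ, A ((c : F) ^ 4) * dwK ψ A *
    (gaussSum (A * T ^ 0) ψ * gaussSum (A * T ^ 0) ψ * gaussSum (A * T ^ 2) ψ *
      gaussSum (A * T ^ 2) ψ) =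
      A ((lam : F) ^ 4) * (jacobiSum (T ^ 3) (T ^ 3) * jacobiSum T A *
        jacobiSum (T * A⁻¹) T) +
      ((if A = 1 then ((Fintype.card F : ℂ) - 1) else 0) +
       (if A = T ^ 2 then ((Fintype.card F : ℂ) - 1) else 0)) := by
    intro A
    rw [pow_zero, mul_one]
    unfold dwK
    by_cases h4 : A ^ 4 = 1
    · rw [if_pos h4, hT.pow4_one A h4, hT.pow4_one A h4]
      rcases hT.all A h4 with hA | hA | hA | hA <;> rw [hA]
      · rw [if_pos rfl, if_neg hT.t2.symm, one_mul, one_mul, inv_one, mul_one,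
          dw_gauss_one ψ hψ, jacobiSum_comm T 1, jacobiSum_one_nontrivial hT.t1]
        field_simp
        linear_combination -g22 + (Fintype.card F : ℂ) * j1133
      · rw [if_neg hT.t1, if_neg hT.t12, hT.m12, mul_inv_cancel, jacobiSum_one_nontrivial hT.t1]
        field_simp
        linear_combination (Fintype.card F : ℂ) * j1133 -
          (gaussSum T ψ * gaussSum (T ^ 3) ψ + T (-1) * (Fintype.card F : ℂ)) * g13 -
          (Fintype.card F : ℂ) ^ 2 * ss
      · rw [if_neg hT.t2, if_pos rfl, hT.inv2, hT.m12, hT.m22, dw_gauss_one ψ hψ,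
          jacobiSum_comm (T ^ 3) T, jT, j32]
        field_simp
        linear_combination -g22 + (Fintype.card F : ℂ) ^ 2 * ss
      · rw [if_neg hT.t3, if_neg hT.t23.symm, hT.inv3, hT.m11, hT.m32, jT,
          jacobiSum_comm (T ^ 2) T]
        field_simp
        linear_combination (Fintype.card F : ℂ) * T (-1) * j32 -
          (gaussSum T ψ * gaussSum (T ^ 3) ψ + T (-1) * (Fintype.card F : ℂ)) * g13
    · have hA1 : A ≠ 1 := by rintro rfl; simp at h4
      have hA2 : A ≠ T ^ 2 := by
        rintro rfl; apply h4; rw [← pow_mul, mul_comm, pow_mul, hT.t4, one_pow]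
      have hB : A * T ≠ 1 := by
        intro h1; apply h4
        have : A = T⁻¹ := eq_inv_of_mul_eq_one_left h1
        rw [this, inv_pow, hT.t4, inv_one]
      have hB2 : A * T ^ 2 ≠ 1 := by
        intro h1; apply h4
        have : A = (T ^ 2)⁻¹ := eq_inv_of_mul_eq_one_left h1
        rw [this, inv_pow, ← pow_mul, mul_comm, pow_mul, hT.t4, one_pow, inv_one]
      have hB3 : A * T ^ 3 ≠ 1 := by
        intro h1; apply h4
        have : A = (T ^ 3)⁻¹ := eq_inv_of_mul_eq_one_left h1
        rw [this, inv_pow, ← pow_mul, mul_comm, pow_mul, hT.t4, one_pow, inv_one]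
      rw [if_neg h4, if_neg hA1, if_neg hA2]
      have i3 : (A * T ^ 3)⁻¹ = T * A⁻¹ := by rw [mul_inv, hT.inv3, mul_comm]
      have i2 : (A * T ^ 2)⁻¹ = T * A⁻¹ * T := by
        rw [mul_inv, hT.inv2, mul_comm, pow_two, mul_assoc, mul_assoc, mul_comm T A⁻¹]
      have hd := hT.hd4 hψ A
      have ja := dw_jac (ψ := ψ) T A (by rw [mul_comm]; exact hB)
      rw [mul_comm T A] at ja
      have jb := dw_jac (ψ := ψ) (T * A⁻¹) T (by rw [← i2, Ne, inv_eq_one]; exact hB2)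
      have gc := dw_gauss_inv hψ _ hB3
      have gb := dw_gauss_inv hψ _ hB2
      rw [i3, MulChar.mul_apply, hT.s3] at gc
      rw [i2, MulChar.mul_apply, hT.s2] at gb
      have na := dw_gauss_ne_zero hψ (A * T)
      have nb := dw_gauss_ne_zero hψ (A * T ^ 2)
      have nc := dw_gauss_ne_zero hψ (A * T ^ 3)
      have nh := dw_gauss_ne_zero hψ (T * A⁻¹ * T)
      have n4 := dw_gauss_ne_zero hψ (A ^ 4)
      rw [hc, mul_pow, map_mul, map_pow A 4 4, add_zero, add_zero]
      field_simp
      apply mul_right_cancel₀ (mul_ne_zero (mul_ne_zero n2 na) (mul_ne_zero nc nh))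
      generalize A ((lam : F) ^ 4) = X at *
      generalize (Fintype.card F : ℂ) = q at *
      generalize A (-1) = m at *
      generalize T (-1) = s at *
      generalize gaussSum (T * A⁻¹ * T) ψ = h2 at *
      generalize gaussSum (T * A⁻¹) ψ = h1 at *
      generalize gaussSum (A * T) ψ = ga at *
      generalize gaussSum (A * T ^ 2) ψ = gb' at *
      generalize gaussSum (A * T ^ 3) ψ = gc' at *
      generalize gaussSum (A ^ 4) ψ = g4 at *
      generalize gaussSum (T ^ 3) ψ = g3 at *
      generalize gaussSum (T ^ 2) ψ = g2 at *
      generalize gaussSum T ψ = g1 at *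
      generalize gaussSum A ψ = g0 at *
      calc _ = X * (A 4 ^ 4 * (g0 * ga * gb' * gc')) * g0 * (gb' * h2) * g2 := by ring
        _ = X * g4 * g0 * (g1 * g3) * (g2 * g2) * (m * q) := by rw [hd, gb]; ring
        _ = X * g4 * g0 * (g1 * g3) * (g1 * g3) * (m * s * q) := by
            rw [g22, g13]; linear_combination (-(X * g4 * g0 * s * q ^ 3 * m)) * ss
        _ = X * g4 * (g3 * g3) * (g1 * g0) * (h1 * g1) * gc' := by rw [← gc]; ring
        _ = _ := by rw [← j33, ← ja, ← jb]; ring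
  unfold dwP
  simp only [hterm, Finset.sum_add_distrib]
  simp only [Finset.sum_ite_eq', Finset.mem_univ, if_true]
  ring
end

end DworkHelpersC

set_option linter.unusedSectionVars false

section DworkHelpersD

variable {F : Type} [Field F] [Fintype F]

lemma dw_jacobiS (A B : MulChar F ℂ) : jacobiS F ![A, B] = jacobiSum A B := by
  unfold jacobiS jacobiSum
  rw [Finset.sum_filter]
  rw [Fintype.sum_equiv (finTwoArrowEquiv F) _
    (fun p : F × F => if p.1 + p.2 = 1 then A p.1 * B p.2 else 0)
    (fun v => by simp [Fin.sum_univ_two, Fin.prod_univ_two])]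
  rw [Fintype.sum_prod_type]
  refine Finset.sum_congr rfl fun x _ => ?_
  have : ∀ y : F, x + y = 1 ↔ y = 1 - x := fun y => by
    constructor
    · intro h; rw [← h]; ring
    · intro h; rw [h]; ring
  simp [this]

lemma dw_gBinom (A B : MulChar F ℂ) :
    gBinom F A B = B (-1) / (Fintype.card F : ℂ) * jacobiSum A B⁻¹ := by
  unfold gBinom
  rw [dw_jacobiS]

lemma dw_orderOf (ω : MulChar F ℂ) (hω : ∀ χ : MulChar F ℂ, ∃ j : ℕ, χ = ω ^ j) :
    orderOf ω = Fintype.card F - 1 := by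
  rw [← dw_card_mulChar, ← Nat.card_eq_fintype_card]
  apply orderOf_eq_card_of_forall_mem_zpowers
  intro χ
  obtain ⟨j, hj⟩ := hω χ
  exact ⟨j, by simp [hj]⟩

lemma dw_sum_range (ω : MulChar F ℂ) (hω : ∀ χ : MulChar F ℂ, ∃ j : ℕ, χ = ω ^ j)
    (f : MulChar F ℂ → ℂ) :
    ∑ j ∈ Finset.range (Fintype.card F - 1), f (ω ^ j) = ∑ A : MulChar F ℂ, f A := by
  have ho := dw_orderOf ω hω
  refine Finset.sum_bij (fun j _ => ω ^ j) (by simp) ?_ ?_ (by simp)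
  · intro a ha b hb h
    rw [← ho] at ha hb
    exact pow_injOn_Iio_orderOf (by simpa using ha) (by simpa using hb) h
  · intro χ _
    obtain ⟨j, hj⟩ := hω χ
    refine ⟨j % orderOf ω, ?_, ?_⟩
    · rw [← ho, Finset.mem_range]
      exact Nat.mod_lt _ (orderOf_pos ω)
    · rw [pow_mod_orderOf, hj]

variable {T : MulChar F ℂ} {ψ : AddChar F ℂ}

lemma DwQ.greene3 (hT : DwQ T) (hψ : ψ.IsPrimitive) (lam c : Fˣ) (hc : (c : F) = 4 * lam)
    (ω : MulChar F ℂ) (hω : ∀ χ : MulChar F ℂ, ∃ j : ℕ, χ = ω ^ j) :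
    ((Fintype.card F : ℂ) - 1) * ((Fintype.card F : ℂ) ^ 2 *
      greeneF F ω ![T, T ^ 2, T ^ 3] ![1, 1] ((lam : F) ^ 4)⁻¹) =
      ∑ A : MulChar F ℂ, A (-1) * A ((c : F) ^ 4) * gaussSum (A⁻¹ ^ 4) ψ * gaussSum A ψ ^ 3 /
        gaussSum A⁻¹ ψ := by
  have hq := dw_card_ne_zero (F := F)
  have hq1 := dw_card_sub_one_ne_zero (F := F)
  have h4 : (4 : F) ≠ 0 := by
    rw [show (4 : F) = 2 * 2 by norm_num]; exact mul_ne_zero hT.two hT.two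
  unfold greeneF
  rw [dw_sum_range ω hω (fun χ => gBinom F (![T, T ^ 2, T ^ 3] 0 * χ) χ *
        (∏ i : Fin 2, gBinom F (![T, T ^ 2, T ^ 3] i.succ * χ) (![1, 1] i * χ)) *
          χ ((lam : F) ^ 4)⁻¹)]
  rw [← Fintype.sum_equiv (Equiv.inv (MulChar F ℂ)) (fun χ : MulChar F ℂ =>
    χ⁻¹ (-1) * χ⁻¹ ((c : F) ^ 4) * gaussSum (χ ^ 4) ψ * gaussSum χ⁻¹ ψ ^ 3 /
        gaussSum χ ψ) (fun A : MulChar F ℂ => A (-1) * A ((c : F) ^ 4) * gaussSum (A⁻¹ ^ 4) ψ *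
        gaussSum A ψ ^ 3 / gaussSum A⁻¹ ψ) (fun χ => by simp)]
  rw [← mul_assoc, ← mul_assoc, Finset.mul_sum]
  refine Finset.sum_congr rfl fun χ _ => ?_
  simp only [Fin.prod_univ_two, Matrix.cons_val_zero, Fin.succ_zero_eq_one, Matrix.cons_val_one,
    Fin.succ_one_eq_two, Matrix.cons_val, one_mul]
  simp only [dw_gBinom]
  have jac : ∀ B : MulChar F ℂ, B ≠ 1 → jacobiSum (B * χ) χ⁻¹ =
      gaussSum (χ * B) ψ * gaussSum χ⁻¹ ψ / gaussSum B ψ := by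
    intro B hB
    have := dw_jac (ψ := ψ) (B * χ) χ⁻¹ (by rwa [mul_inv_cancel_right])
    rw [mul_inv_cancel_right, mul_comm B χ] at this
    rw [mul_comm B χ]
    exact eq_div_of_mul_eq (dw_gauss_ne_zero hψ B) this
  rw [jac T hT.t1, jac _ hT.t2, jac _ hT.t3]
  have hd := hT.hd4 hψ χ
  have n0 := dw_gauss_ne_zero hψ χ
  have n1 := dw_gauss_ne_zero hψ T
  have n2 := dw_gauss_ne_zero hψ (T ^ 2)
  have n3 := dw_gauss_ne_zero hψ (T ^ 3)
  have m := dw_neg_one_sq χ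
  have x1 : χ⁻¹ ((c : F) ^ 4) = χ (((lam : F) ^ 4)⁻¹) / χ 4 ^ 4 := by
    have hχ4 : χ 4 ≠ 0 := (h4.isUnit.map χ).ne_zero
    rw [MulChar.inv_apply', eq_div_iff (pow_ne_zero 4 hχ4), ← map_pow, ← map_mul, hc]
    congr 1
    have := lam.ne_zero
    field_simp
  have hχ4 : χ 4 ≠ 0 := (h4.isUnit.map χ).ne_zero
  rw [x1, dw_inv_neg_one]
  generalize χ (((lam : F) ^ 4)⁻¹) = X
  field_simp
  generalize gaussSum χ⁻¹ ψ = h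
  linear_combination (χ (-1) ^ 3 * h ^ 3 * X) * hd + gaussSum (χ ^ 4) ψ *
    (gaussSum T ψ * gaussSum (T ^ 2) ψ * gaussSum (T ^ 3) ψ) * h ^ 3 * X * χ (-1) * m

lemma dw_inv_unit (A : MulChar F ℂ) (y : Fˣ) : A⁻¹ (y : F) = A ((y⁻¹ : Fˣ) : F) := by
  rw [MulChar.inv_apply', Units.val_inv_eq_inv_val]

lemma dw_phi_sum (hT : DwQ T) (lam : Fˣ) :
    ∑ A : MulChar F ℂ, A ((lam : F) ^ 4) * jacobiSum (T ^ 2) A =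
      ((Fintype.card F : ℂ) - 1) * (T ^ 2) (1 - (lam : F) ^ 4) := by
  have h1 : ∀ A : MulChar F ℂ, A ((lam : F) ^ 4) * jacobiSum (T ^ 2) A =
      ∑ u : Fˣ, (T ^ 2) (1 - (u : F)) * A ((lam ^ 4 * u : Fˣ) : F) := by
    intro A
    rw [jacobiSum_comm]
    unfold jacobiSum
    rw [dw_sum_units, MulChar.map_zero, zero_mul, zero_add, Finset.mul_sum]
    refine Finset.sum_congr rfl fun u _ => ?_
    rw [Units.val_mul, map_mul, Units.val_pow_eq_pow_val]; ring
  simp only [h1]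
  rw [Finset.sum_comm]
  simp only [← Finset.mul_sum, dw_orth]
  have h2 : ∀ u : Fˣ, lam ^ 4 * u = 1 ↔ u = (lam ^ 4)⁻¹ := fun u => by
    rw [mul_comm]; exact mul_eq_one_iff_eq_inv
  simp only [h2, mul_ite, mul_zero, Finset.sum_ite_eq', Finset.mem_univ, if_true]
  rw [mul_comm]
  congr 1
  have h3 : (T ^ 2) ((lam : F) ^ 4) = 1 := hT.pow4_one (T ^ 2) (by
    rw [← pow_mul, mul_comm, pow_mul, hT.t4, one_pow]) lam
  have h5 : (1 - (lam : F) ^ 4) = (-1) * ((lam : F) ^ 4 * (1 - (((lam ^ 4)⁻¹ : Fˣ) : F))) := by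
    have := lam.ne_zero
    rw [Units.val_inv_eq_inv_val, Units.val_pow_eq_pow_val]
    field_simp
    ring
  rw [h5, map_mul, map_mul, h3, hT.s2, one_mul, one_mul]

lemma dw_greene2 (hT : DwQ T) (lam : Fˣ) :
    ((Fintype.card F : ℂ) - 1) * ((Fintype.card F : ℂ) ^ 2 * gBinom F (T ^ 3) T *
      greene2F1 F (T ^ 3) T (T ^ 2) ((lam : F) ^ 4)⁻¹) =
    ∑ A : MulChar F ℂ, A ((lam : F) ^ 4) * (jacobiSum (T ^ 3) (T ^ 3) * jacobiSum T A *
        jacobiSum (T * A⁻¹) T) := by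
  have hq := dw_card_ne_zero (F := F)
  have h1 : ∀ A : MulChar F ℂ, A ((lam : F) ^ 4) * (jacobiSum (T ^ 3) (T ^ 3) * jacobiSum T A *
        jacobiSum (T * A⁻¹) T) = ∑ y : Fˣ, ∑ u : Fˣ, jacobiSum (T ^ 3) (T ^ 3) *
        (T (y : F) * T (1 - (y : F)) * T (1 - (u : F))) * A ((lam ^ 4 * u * y⁻¹ : Fˣ) : F) := by
    intro A
    rw [jacobiSum_comm T A]
    unfold jacobiSum
    rw [dw_sum_units (fun x => A x * T (1 - x)), MulChar.map_zero, zero_mul, zero_add,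
      dw_sum_units (fun x => (T * A⁻¹) x * T (1 - x)), MulChar.map_zero, zero_mul, zero_add,
      Finset.mul_sum, Finset.mul_sum]
    refine Finset.sum_congr rfl fun y _ => ?_
    rw [Finset.mul_sum, Finset.sum_mul, Finset.mul_sum]
    refine Finset.sum_congr rfl fun u _ => ?_
    rw [Units.val_mul, Units.val_mul, map_mul, map_mul, Units.val_pow_eq_pow_val,
      MulChar.mul_apply, dw_inv_unit]
    ring
  simp only [h1]
  rw [Finset.sum_comm]
  have h2 : ∀ y : Fˣ, ∑ A : MulChar F ℂ, ∑ u : Fˣ, jacobiSum (T ^ 3) (T ^ 3) *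
        (T (y : F) * T (1 - (y : F)) * T (1 - (u : F))) * A ((lam ^ 4 * u * y⁻¹ : Fˣ) : F) =
      jacobiSum (T ^ 3) (T ^ 3) * (T (y : F) * T (1 - (y : F)) *
        T (1 - ((lam : F) ^ 4)⁻¹ * y)) * ((Fintype.card F : ℂ) - 1) := by
    intro y
    rw [Finset.sum_comm]
    simp only [← Finset.mul_sum, dw_orth]
    have h2 : ∀ u : Fˣ, lam ^ 4 * u * y⁻¹ = 1 ↔ u = (lam ^ 4)⁻¹ * y := fun u => by
      rw [mul_inv_eq_one, eq_inv_mul_iff_mul_eq]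
    simp only [h2, mul_ite, mul_zero, Finset.sum_ite_eq', Finset.mem_univ, if_true]
    simp
  simp only [h2]
  unfold greene2F1
  rw [dw_gBinom, hT.inv1, hT.inv3, hT.m32, hT.m12, hT.s3,
    MulChar.one_apply (by have := lam.isUnit.pow 4; exact this.inv)]
  rw [dw_sum_units, MulChar.map_zero, zero_mul, zero_mul, zero_add]
  have ss := dw_neg_one_sq T
  have : ∑ y : Fˣ, jacobiSum (T ^ 3) (T ^ 3) * (T (y : F) * T (1 - (y : F)) *
        T (1 - ((lam : F) ^ 4)⁻¹ * y)) * ((Fintype.card F : ℂ) - 1) =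
      jacobiSum (T ^ 3) (T ^ 3) * ((Fintype.card F : ℂ) - 1) * ∑ y : Fˣ,
        T (y : F) * T (1 - (y : F)) * T (1 - ((lam : F) ^ 4)⁻¹ * y) := by
    rw [Finset.mul_sum]
    exact Finset.sum_congr rfl fun y _ => by ring
  rw [this]
  generalize ∑ y : Fˣ, T (y : F) * T (1 - (y : F)) * T (1 - ((lam : F) ^ 4)⁻¹ * y) = S
  field_simp
  linear_combination ((Fintype.card F : ℂ) - 1) * jacobiSum (T ^ 3) (T ^ 3) * S * ss

end DworkHelpersD

set_option linter.unusedSectionVars false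

section DworkHelpersE

variable {F : Type} [Field F] [Fintype F]

/-- Indicator of zero. -/
noncomputable def dwδ (x : F) : ℂ := if x = 0 then 1 else 0

lemma dwδ_zero : dwδ (0 : F) = 1 := by simp [dwδ]
lemma dwδ_mul (a : F) (ha : a ≠ 0) (x : F) : dwδ (a * x) = dwδ x := by
  simp [dwδ, ha]
lemma dwδ_unit_pow (a : Fˣ) (n : ℕ) : dwδ ((a : F) ^ n) = 0 := by
  simp [dwδ]

lemma dw_count_affine (lam : F) :
    (dworkCount F 4 lam : ℂ) * ((Fintype.card F : ℂ) - 1) + 1 =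
      ∑ v : Fin 4 → F, dwδ (∑ i, v i ^ 4 - 4 * lam * ∏ i, v i) := by
  let Q : (Fin 4 → F) → Prop := fun v => ∑ i, v i ^ 4 = (4 : ℕ) * lam * ∏ i, v i
  have hQ : ∀ (a : Fˣ) (v : Fin 4 → F), Q (a • v) ↔ Q v := by
    intro a v
    simp only [Q, Pi.smul_apply, Units.smul_def, smul_eq_mul, mul_pow, ← Finset.mul_sum,
      Finset.prod_mul_distrib, Finset.prod_const, Finset.card_univ, Fintype.card_fin]
    rw [show ((4 : ℕ) : F) * lam * ((a : F) ^ 4 * ∏ i, v i) =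
      (a : F) ^ 4 * (((4 : ℕ) : F) * lam * ∏ i, v i) by ring]
    exact mul_right_inj' (pow_ne_zero 4 a.ne_zero)
  let e : ({P : Projectivization F (Fin 4 → F) // Q P.rep} × Fˣ) → {v : Fin 4 → F // v ≠ 0 ∧ Q v} :=
    fun p => ⟨p.2 • p.1.1.rep, by
      rw [Ne, smul_eq_zero_iff_eq]; exact p.1.1.rep_nonzero, (hQ _ _).2 p.1.2⟩
  have he : Function.Bijective e := by
    constructor
    · rintro ⟨⟨P, hP⟩, a⟩ ⟨⟨P', hP'⟩, b⟩ h
      have h1 : a • P.rep = b • P'.rep := congrArg Subtype.val h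
      have h2 : P = P' := by
        rw [← P.mk_rep, ← P'.mk_rep, Projectivization.mk_eq_mk_iff]
        exact ⟨a⁻¹ * b, by rw [mul_smul, ← h1, inv_smul_smul]⟩
      subst h2
      have h3 : a = b := by
        have h4 : ((a : F) - b) • P.rep = 0 := by
          rw [sub_smul, sub_eq_zero]; exact h1
        rcases smul_eq_zero.mp h4 with h5 | h5
        · exact Units.ext (sub_eq_zero.mp h5)
        · exact absurd h5 P.rep_nonzero
      subst h3
      rfl
    · rintro ⟨v, hv, hv'⟩
      obtain ⟨a, ha⟩ := Projectivization.exists_smul_eq_mk_rep F v hv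
      refine ⟨⟨⟨Projectivization.mk F v hv, ?_⟩, a⁻¹⟩, ?_⟩
      · rw [← ha, hQ]; exact hv'
      · apply Subtype.ext
        change a⁻¹ • (Projectivization.mk F v hv).rep = v
        rw [← ha, inv_smul_smul]
  have hc := Nat.card_congr (Equiv.ofBijective e he)
  rw [Nat.card_prod] at hc
  have hc' : (dworkCount F 4 lam : ℂ) * ((Fintype.card F : ℂ) - 1) =
      (Nat.card {v : Fin 4 → F // v ≠ 0 ∧ Q v} : ℂ) := by
    rw [← hc, ← dw_card_units, Nat.card_eq_fintype_card (α := Fˣ)]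
    push_cast
    rfl
  rw [hc', Nat.card_eq_fintype_card, Fintype.card_subtype]
  have h0 : ∑ v : Fin 4 → F, dwδ (∑ i, v i ^ 4 - 4 * lam * ∏ i, v i) =
      ∑ v : Fin 4 → F, if Q v then (1 : ℂ) else 0 := by
    refine Finset.sum_congr rfl fun v _ => ?_
    simp [dwδ, Q, sub_eq_zero]
  rw [h0, Finset.card_filter]
  push_cast
  have hQ0 : Q 0 := by simp [Q]
  have h1 : ∀ v : Fin 4 → F, (if Q v then (1 : ℂ) else 0) =
      (if v ≠ 0 ∧ Q v then (1 : ℂ) else 0) + if v = 0 then 1 else 0 := by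
    intro v
    by_cases hv : v = 0
    · subst hv; simp [hQ0]
    · simp [hv]
  simp only [h1, Finset.sum_add_distrib, Finset.sum_ite_eq', Finset.mem_univ, if_true]

lemma dw_sum_fin4 (f : F → F → F → F → ℂ) :
    ∑ v : Fin 4 → F, f (v 0) (v 1) (v 2) (v 3) = ∑ x1, ∑ x2, ∑ x3, ∑ x4, f x1 x2 x3 x4 := by
  refine (Fintype.sum_equiv (⟨fun v => (v 0, v 1, v 2, v 3),
    fun p => ![p.1, p.2.1, p.2.2.1, p.2.2.2], fun v => by ext i; fin_cases i <;> rfl,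
    fun p => rfl⟩ : (Fin 4 → F) ≃ F × F × F × F)
    (fun v => f (v 0) (v 1) (v 2) (v 3))
    (fun p => f p.1 p.2.1 p.2.2.1 p.2.2.2) (fun v => rfl)).trans ?_
  simp only [Fintype.sum_prod_type]

/-- torus points in dimension 2, 3, 4 -/
noncomputable def dwA2 (F : Type) [Field F] [Fintype F] : ℂ :=
  ∑ x : Fˣ, ∑ y : Fˣ, dwδ ((x : F) ^ 4 + (y : F) ^ 4)
noncomputable def dwA3 (F : Type) [Field F] [Fintype F] : ℂ :=
  ∑ x : Fˣ, ∑ y : Fˣ, ∑ z : Fˣ, dwδ ((x : F) ^ 4 + (y : F) ^ 4 + (z : F) ^ 4)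
noncomputable def dwA4 (c : F) : ℂ :=
  ∑ x : Fˣ, ∑ y : Fˣ, ∑ z : Fˣ, ∑ w : Fˣ,
    dwδ ((x : F) ^ 4 + (y : F) ^ 4 + (z : F) ^ 4 + (w : F) ^ 4 - c * (x * y * z * w))

lemma dw_split (c : F) :
    ∑ x1 : F, ∑ x2 : F, ∑ x3 : F, ∑ x4 : F,
      dwδ (x1 ^ 4 + x2 ^ 4 + x3 ^ 4 + x4 ^ 4 - c * (x1 * x2 * x3 * x4)) =
    dwA4 c + 4 * dwA3 F + 6 * dwA2 F + 1 := by
  unfold dwA4 dwA3 dwA2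
  simp only [dw_sum_units, Finset.sum_add_distrib, mul_zero, zero_mul, sub_zero,
    zero_pow (four_ne_zero), zero_add, add_zero, dwδ_unit_pow, dwδ_zero, Finset.sum_const_zero]
  ring

lemma dw_count_split (lam : F) :
    (dworkCount F 4 lam : ℂ) * ((Fintype.card F : ℂ) - 1) =
      dwA4 (4 * lam) + 4 * dwA3 F + 6 * dwA2 F := by
  have h := dw_count_affine lam
  have h2 := dw_sum_fin4 (fun x1 x2 x3 x4 : F =>
    dwδ (x1 ^ 4 + x2 ^ 4 + x3 ^ 4 + x4 ^ 4 - 4 * lam * (x1 * x2 * x3 * x4)))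
  rw [dw_split] at h2
  simp only [Fin.sum_univ_four, Fin.prod_univ_four] at h
  rw [h2] at h
  linear_combination h

lemma dw_scale_units (a : Fˣ) (f : Fˣ → ℂ) : ∑ y : Fˣ, f y = ∑ y : Fˣ, f (a * y) :=
  (Fintype.sum_equiv (Equiv.mulLeft a) _ _ (fun _ => rfl)).symm

variable {T : MulChar F ℂ} {ψ : AddChar F ℂ}

lemma dwδ_sum (f : Fˣ → ℂ) (a : Fˣ) : ∑ u : Fˣ, f u * dwδ ((u : F) - a) = f a := by
  have : ∀ u : Fˣ, f u * dwδ ((u : F) - a) = if u = a then f u else 0 := by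
    intro u
    simp [dwδ, sub_eq_zero, Units.ext_iff]
  simp [this]

lemma DwQ.A2 (hT : DwQ T) : dwA2 F = ((Fintype.card F : ℂ) - 1) * (2 + 2 * T (-1)) := by
  unfold dwA2
  have h1 : ∀ x : Fˣ, ∑ y : Fˣ, dwδ ((x : F) ^ 4 + (y : F) ^ 4) = 2 + 2 * T (-1) := by
    intro x
    rw [dw_scale_units x]
    have h2 : ∀ y : Fˣ, dwδ ((x : F) ^ 4 + ((x * y : Fˣ) : F) ^ 4) =
        dwδ (((y ^ 4 : Fˣ) : F) - ((-1 : Fˣ) : F)) := by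
      intro y
      symm
      rw [← dwδ_mul ((x : F) ^ 4) (pow_ne_zero 4 x.ne_zero)]
      congr 1
      push_cast
      ring
    simp only [h2]
    rw [hT.fourth_sum (fun u => dwδ ((u : F) - ((-1 : Fˣ) : F)))]
    have h3 : ∀ a, ∑ u : Fˣ, (T ^ a) (u : F) * dwδ ((u : F) - ((-1 : Fˣ) : F)) = (T ^ a) (-1) := by
      intro a
      exact (dwδ_sum (fun u : Fˣ => (T ^ a) (u : F)) (-1)).trans (by simp)
    simp only [h3, Finset.sum_range_succ, Finset.sum_range_zero, pow_zero, pow_one]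
    rw [MulChar.one_apply (by simp), hT.s2, hT.s3]
    ring
  simp only [h1, Finset.sum_const, Finset.card_univ, nsmul_eq_mul, dw_card_units]

lemma DwQ.A3_pre (hT : DwQ T) : dwA3 F = ((Fintype.card F : ℂ) - 1) *
    ∑ a ∈ Finset.range 4, ∑ b ∈ Finset.range 4,
      (T ^ a) (-1) * (T ^ b) (-1) * jacobiSum (T ^ a) (T ^ b) := by
  unfold dwA3
  have h1 : ∀ x : Fˣ, ∑ y : Fˣ, ∑ z : Fˣ, dwδ ((x : F) ^ 4 + (y : F) ^ 4 + (z : F) ^ 4) =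
     ∑ a ∈ Finset.range 4, ∑ b ∈ Finset.range 4,
      (T ^ a) (-1) * (T ^ b) (-1) * jacobiSum (T ^ a) (T ^ b) := by
    intro x
    rw [dw_scale_units x]
    have h2 : ∀ y : Fˣ, ∑ z : Fˣ, dwδ ((x : F) ^ 4 + ((x * y : Fˣ) : F) ^ 4 + (z : F) ^ 4) =
        ∑ z : Fˣ, dwδ (1 + ((y ^ 4 : Fˣ) : F) + ((z ^ 4 : Fˣ) : F)) := by
      intro y
      rw [dw_scale_units x]
      refine Finset.sum_congr rfl fun z _ => ?_
      symm
      rw [← dwδ_mul ((x : F) ^ 4) (pow_ne_zero 4 x.ne_zero)]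
      congr 1
      push_cast
      ring
    simp only [h2]
    rw [hT.fourth_sum (fun u => ∑ z : Fˣ, dwδ (1 + (u : F) + ((z ^ 4 : Fˣ) : F)))]
    refine Finset.sum_congr rfl fun a _ => ?_
    have h3 : ∀ u : Fˣ, ∑ z : Fˣ, dwδ (1 + (u : F) + ((z ^ 4 : Fˣ) : F)) =
      ∑ b ∈ Finset.range 4, ∑ v : Fˣ, (T ^ b) (v : F) * dwδ (1 + (u : F) + (v : F)) :=
      fun u => hT.fourth_sum (fun v => dwδ (1 + (u : F) + (v : F)))
    simp only [h3, Finset.mul_sum]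
    rw [Finset.sum_comm]
    refine Finset.sum_congr rfl fun b _ => ?_
    unfold jacobiSum
    rw [dw_sum_units (fun x : F => (T ^ a) x * (T ^ b) (1 - x)), MulChar.map_zero, zero_mul,
      zero_add, Finset.mul_sum, dw_scale_units (-1)]
    refine Finset.sum_congr rfl fun u _ => ?_
    rw [← Finset.mul_sum]
    have h4 : ∑ v : Fˣ, (T ^ b) (v : F) * dwδ (1 + ((-1 * u : Fˣ) : F) + (v : F)) =
        (T ^ b) (-1 * (1 - (u : F))) := by
      have := dw_sum_units (fun v : F => (T ^ b) v * dwδ (1 + ((-1 * u : Fˣ) : F) + v))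
      rw [MulChar.map_zero, zero_mul, zero_add] at this
      rw [← this]
      have h5 : ∀ v : F, (T ^ b) v * dwδ (1 + ((-1 * u : Fˣ) : F) + v) =
          if v = -1 * (1 - (u : F)) then (T ^ b) v else 0 := by
        intro v
        have : (1 + ((-1 * u : Fˣ) : F) + v = 0) ↔ v = -1 * (1 - (u : F)) := by
          push_cast
          constructor
          · intro h; linear_combination h
          · intro h; rw [h]; ring
        simp only [dwδ, this]
        split_ifs <;> ring
      simp only [h5, Finset.sum_ite_eq', Finset.mem_univ, if_true]
    rw [h4, map_mul, Units.val_mul, map_mul]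
    push_cast
    ring
  simp only [h1, Finset.sum_const, Finset.card_univ, nsmul_eq_mul, dw_card_units]

lemma DwQ.A3 (hT : DwQ T) : dwA3 F = ((Fintype.card F : ℂ) - 1) *
    ((Fintype.card F : ℂ) - 5 - 6 * T (-1) +
      3 * (jacobiSum T T + jacobiSum (T ^ 3) (T ^ 3))) := by
  rw [hT.A3_pre]
  congr 1
  have ss := dw_neg_one_sq T
  have h1 : (1 : MulChar F ℂ) (-1) = 1 := MulChar.one_apply (by simp)
  have h4 : (4 : F) ≠ 0 := by
    rw [show (4 : F) = 2 * 2 by norm_num]; exact mul_ne_zero hT.two hT.two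
  have jT : jacobiSum T (T ^ 3) = - T (-1) := by
    have := jacobiSum_nontrivial_inv hT.t1
    rwa [hT.inv1] at this
  have j22 : jacobiSum (T ^ 2) (T ^ 2) = -1 := by
    have := jacobiSum_nontrivial_inv hT.t2
    rwa [hT.inv2, hT.s2] at this
  -- T 4 = T (-1), from 4 * (-1)... a fourth power up to sign
  obtain ⟨ψ, hψ⟩ := dw_exists_primitive (F := F)
  have n2 := dw_gauss_ne_zero hψ (T ^ 2)
  have n1 := dw_gauss_ne_zero hψ T
  have n3 := dw_gauss_ne_zero hψ (T ^ 3)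
  have hd := hT.hd2 hψ T
  rw [hT.m12, hT.g13 hψ] at hd
  have hT4 : T 4 = T (-1) := by
    rw [hT.g22 hψ] at hd
    have hq := dw_card_ne_zero (F := F)
    have : T 4 * T (-1) = 1 := by
      apply mul_right_cancel₀ hq
      linear_combination hd
    linear_combination T (-1) * this - T 4 * ss
  have hT34 : (T ^ 3) 4 = T (-1) := by
    rw [MulChar.pow_apply' _ (by norm_num), hT4]
    linear_combination T (-1) * ss
  have j1 := hT.jac_self T hT.t1
  have j3 := hT.jac_self (T ^ 3) hT.t3
  rw [hT4] at j1
  rw [hT34] at j3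
  simp only [Finset.sum_range_succ, Finset.sum_range_zero, hT.s2, hT.s3, pow_zero, pow_one, h1]
  rw [jacobiSum_comm T 1, jacobiSum_comm (T ^ 2) 1, jacobiSum_comm (T ^ 3) 1,
    jacobiSum_comm T (T ^ 2), jacobiSum_comm (T ^ 3) (T ^ 2), jacobiSum_comm (T ^ 3) T,
    jacobiSum_one_one, jacobiSum_one_nontrivial hT.t1, jacobiSum_one_nontrivial hT.t2,
    jacobiSum_one_nontrivial hT.t3, jT, j22, ← j1, ← j3]
  linear_combination (3 * jacobiSum T T + 3 * jacobiSum (T ^ 3) (T ^ 3) - 2 * T (-1)) * ss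

end DworkHelpersE

set_option linter.unusedSectionVars false

section DworkHelpersF

variable {F : Type} [Field F] [Fintype F]
variable {T : MulChar F ℂ} {ψ : AddChar F ℂ}

/-- twisted torus sum -/
noncomputable def dwW (T : MulChar F ℂ) (c : Fˣ) (a b : ℕ) : ℂ :=
  ∑ u : Fˣ, ∑ w : Fˣ, (T ^ a) (u : F) * ((T ^ b) (w : F) *
    ∑ v : Fˣ, dwδ (1 + (u : F) + (w : F) + (v : F) ^ 4 * (((u * w)⁻¹ : Fˣ) : F) - (c : F) * v))

lemma DwQ.A4_pre (hT : DwQ T) (c : Fˣ) : dwA4 (c : F) = ((Fintype.card F : ℂ) - 1) *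
    ∑ a ∈ Finset.range 4, ∑ b ∈ Finset.range 4, dwW T c a b := by
  unfold dwA4
  have h1 : ∀ x : Fˣ, ∑ y : Fˣ, ∑ z : Fˣ, ∑ w : Fˣ,
      dwδ ((x : F) ^ 4 + (y : F) ^ 4 + (z : F) ^ 4 + (w : F) ^ 4 - (c : F) * (x * y * z * w)) =
      ∑ a ∈ Finset.range 4, ∑ b ∈ Finset.range 4, dwW T c a b := by
    intro x
    let g : Fˣ → Fˣ → ℂ := fun u w => ∑ v : Fˣ,
      dwδ (1 + (u : F) + (w : F) + (v : F) ^ 4 * (((u * w)⁻¹ : Fˣ) : F) - (c : F) * v)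
    have h2 : ∀ y z : Fˣ, ∑ w : Fˣ, dwδ ((x : F) ^ 4 + ((x * y : Fˣ) : F) ^ 4 +
        ((x * z : Fˣ) : F) ^ 4 + (w : F) ^ 4 - (c : F) * (x * (x * y : Fˣ) * (x * z : Fˣ) * w)) =
        g (y ^ 4) (z ^ 4) := by
      intro y z
      rw [dw_scale_units (x * y⁻¹ * z⁻¹)]
      refine Finset.sum_congr rfl fun v _ => ?_
      symm
      rw [← dwδ_mul ((x : F) ^ 4) (pow_ne_zero 4 x.ne_zero)]
      congr 1
      have hy := y.ne_zero
      have hz := z.ne_zero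
      push_cast
      field_simp
    rw [dw_scale_units x]
    have h3 : ∀ y : Fˣ, ∑ z : Fˣ, ∑ w : Fˣ, dwδ ((x : F) ^ 4 + ((x * y : Fˣ) : F) ^ 4 +
        (z : F) ^ 4 + (w : F) ^ 4 - (c : F) * (x * (x * y : Fˣ) * z * w)) =
        ∑ z : Fˣ, g (y ^ 4) (z ^ 4) := by
      intro y
      rw [dw_scale_units x]
      exact Finset.sum_congr rfl fun z _ => h2 y z
    simp only [h3]
    rw [hT.fourth_sum (fun u => ∑ z : Fˣ, g u (z ^ 4))]
    refine Finset.sum_congr rfl fun a _ => ?_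
    have h4 : ∀ u : Fˣ, ∑ z : Fˣ, g u (z ^ 4) =
        ∑ b ∈ Finset.range 4, ∑ w : Fˣ, (T ^ b) (w : F) * g u w :=
      fun u => hT.fourth_sum (fun w => g u w)
    simp only [h4, Finset.mul_sum]
    rw [Finset.sum_comm]
    refine Finset.sum_congr rfl fun b _ => ?_
    simp only [dwW, g, Finset.mul_sum]
  simp only [h1, Finset.sum_const, Finset.card_univ, nsmul_eq_mul, dw_card_units]

/-- Character sum of W. -/
lemma DwQ.W_eq (hT : DwQ T) (c : Fˣ) (a b d : ℕ) (h : T ^ (a + b + d) = 1) :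
    ((Fintype.card F : ℂ) - 1) * dwW T c a b =
      ∑ A : MulChar F ℂ, A ((c : F) ^ 4) * dwR (A * T ^ a) (A * T ^ b) A (A * T ^ d) 1 := by
  have hR : ∀ A : MulChar F ℂ, A ((c : F) ^ 4) * dwR (A * T ^ a) (A * T ^ b) A (A * T ^ d) 1 =
      ∑ y4 : Fˣ, ∑ y1 : Fˣ, ∑ y2 : Fˣ, ∑ y3 : Fˣ,
        (T ^ a) (y1 : F) * (T ^ b) (y2 : F) * (T ^ d) (y4 : F) *
          dwδ ((y1 : F) + y2 + y3 + y4 - 1) *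
          A (((c ^ 4 * y1 * y2 * y4) * y3 : Fˣ) : F) := by
    intro A
    unfold dwR
    simp only [dw_sum_units, MulChar.map_zero, zero_mul, mul_zero, ite_self,
      Finset.sum_const_zero, zero_add, add_zero]
    have e1 : ∀ y1 y2 : Fˣ, ∀ G : Fˣ → Fˣ → ℂ, ∑ y3 : Fˣ, ∑ y4 : Fˣ, G y3 y4 =
       ∑ y4 : Fˣ, ∑ y3 : Fˣ, G y3 y4 := fun _ _ G => Finset.sum_comm
    rw [Finset.mul_sum]
    simp only [Finset.mul_sum]
    symm
    rw [Finset.sum_comm]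
    refine Finset.sum_congr rfl fun y1 _ => ?_
    rw [Finset.sum_comm]
    refine Finset.sum_congr rfl fun y2 _ => ?_
    rw [Finset.sum_comm]
    refine Finset.sum_congr rfl fun y3 _ => ?_
    refine Finset.sum_congr rfl fun y4 _ => ?_
    simp only [dwδ, sub_eq_zero, MulChar.mul_apply]
    push_cast
    simp only [map_mul]
    split_ifs <;> ring
  simp only [hR]
  rw [Finset.sum_comm]
  have hS : ∀ y4 : Fˣ, ∑ A : MulChar F ℂ, ∑ y1 : Fˣ, ∑ y2 : Fˣ, ∑ y3 : Fˣ,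
        (T ^ a) (y1 : F) * (T ^ b) (y2 : F) * (T ^ d) (y4 : F) *
          dwδ ((y1 : F) + y2 + y3 + y4 - 1) *
          A (((c ^ 4 * y1 * y2 * y4) * y3 : Fˣ) : F) =
      ((Fintype.card F : ℂ) - 1) * ∑ y1 : Fˣ, ∑ y2 : Fˣ,
        (T ^ a) (y1 : F) * (T ^ b) (y2 : F) * (T ^ d) (y4 : F) *
          dwδ ((y1 : F) + y2 + (((c ^ 4 * y1 * y2 * y4)⁻¹ : Fˣ) : F) + y4 - 1) := by
    intro y4
    rw [Finset.sum_comm, Finset.mul_sum]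
    refine Finset.sum_congr rfl fun y1 _ => ?_
    rw [Finset.sum_comm, Finset.mul_sum]
    refine Finset.sum_congr rfl fun y2 _ => ?_
    rw [Finset.sum_comm]
    simp only [← Finset.mul_sum, dw_orth]
    have : ∀ y3 : Fˣ, (c ^ 4 * y1 * y2 * y4 * y3 = 1) ↔ y3 = (c ^ 4 * y1 * y2 * y4)⁻¹ := by
      intro y3
      rw [mul_eq_one_iff_inv_eq, eq_comm]
    simp only [this, mul_ite, mul_zero, Finset.sum_ite_eq', Finset.mem_univ, if_true]
    ring
  simp only [hS]
  rw [← Finset.mul_sum]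
  congr 1
  unfold dwW
  simp only [Finset.mul_sum]
  have e2 : ∀ u : Fˣ, ∀ G : Fˣ → Fˣ → ℂ, ∑ y3 : Fˣ, ∑ y4 : Fˣ, G y3 y4 =
       ∑ y4 : Fˣ, ∑ y3 : Fˣ, G y3 y4 := fun _ G => Finset.sum_comm
  have e3 : ∀ G : Fˣ → Fˣ → Fˣ → ℂ, ∑ u : Fˣ, ∑ w : Fˣ, ∑ v : Fˣ, G u w v =
      ∑ v : Fˣ, ∑ u : Fˣ, ∑ w : Fˣ, G u w v := by
    intro G
    rw [Finset.sum_comm]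
    rw [Finset.sum_congr rfl fun w _ => Finset.sum_comm]
    rw [Finset.sum_comm]
    exact Finset.sum_congr rfl fun v _ => Finset.sum_comm
  rw [e3]
  symm
  refine Fintype.sum_equiv (⟨fun y => (c * y)⁻¹, fun v => (c * v)⁻¹,
    fun y => by simp, fun v => by simp⟩ : Fˣ ≃ Fˣ) _ _ fun y4 => ?_
  refine Fintype.sum_equiv (Equiv.mulLeft y4⁻¹) _ _ fun y1 => ?_
  refine Fintype.sum_equiv (Equiv.mulLeft y4⁻¹) _ _ fun y2 => ?_
  change _ = (T ^ a) ((y4⁻¹ * y1 : Fˣ) : F) * ((T ^ b) ((y4⁻¹ * y2 : Fˣ) : F) *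
    dwδ (1 + ((y4⁻¹ * y1 : Fˣ) : F) + ((y4⁻¹ * y2 : Fˣ) : F) + (((c * y4)⁻¹ : Fˣ) : F) ^ 4 *
      (((y4⁻¹ * y1 * (y4⁻¹ * y2))⁻¹ : Fˣ) : F) - (c : F) * (((c * y4)⁻¹ : Fˣ) : F)))
  have hd : dwδ (1 + ((y4⁻¹ * y1 : Fˣ) : F) + ((y4⁻¹ * y2 : Fˣ) : F) + (((c * y4)⁻¹ : Fˣ) : F) ^ 4 *
      (((y4⁻¹ * y1 * (y4⁻¹ * y2))⁻¹ : Fˣ) : F) - (c : F) * (((c * y4)⁻¹ : Fˣ) : F)) =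
      dwδ ((y1 : F) + y2 + (((c ^ 4 * y1 * y2 * y4)⁻¹ : Fˣ) : F) + y4 - 1) := by
    rw [← dwδ_mul (y4 : F) y4.ne_zero]
    congr 1
    have h1 := y1.ne_zero
    have h2 := y2.ne_zero
    have h4 := y4.ne_zero
    have hc := c.ne_zero
    push_cast
    field_simp
    ring
  have hch : (T ^ d) (y4 : F) = (T ^ a) ((y4⁻¹ : Fˣ) : F) * (T ^ b) ((y4⁻¹ : Fˣ) : F) := by
    have h5 : (T ^ (a + b + d)) (y4 : F) = 1 := by rw [h]; simp
    have h6 : ∀ n, (T ^ n) (y4 : F) * (T ^ n) ((y4⁻¹ : Fˣ) : F) = 1 := by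
      intro n
      rw [← map_mul]; simp
    rw [pow_add, pow_add, MulChar.mul_apply, MulChar.mul_apply] at h5
    linear_combination (T ^ a) ((y4⁻¹ : Fˣ) : F) * (T ^ b) ((y4⁻¹ : Fˣ) : F) * h5 -
      (T ^ d) (y4 : F) * (T ^ b) (y4 : F) * (T ^ b) ((y4⁻¹ : Fˣ) : F) * h6 a -
      (T ^ d) (y4 : F) * h6 b
  rw [hd, hch, Units.val_mul, Units.val_mul, map_mul, map_mul]
  ring

end DworkHelpersF

set_option linter.unusedSectionVars false

section DworkHelpersG

variable {F : Type} [Field F] [Fintype F]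
variable {T : MulChar F ℂ} {ψ : AddChar F ℂ}

lemma DwQ.A4 (hT : DwQ T) (hψ : ψ.IsPrimitive) (c : Fˣ) : dwA4 (c : F) =
    dwP T ψ c 0 0 0 0 + ((Fintype.card F : ℂ) - 1) ^ 4 / (Fintype.card F : ℂ) +
      3 * dwP T ψ c 0 0 2 2 + 12 * dwP T ψ c 0 0 1 3 := by
  rw [hT.A4_pre c, Finset.mul_sum]
  simp only [Finset.mul_sum]
  have key : ∀ a b d : ℕ, T ^ (a + b + d) = 1 →
      ((Fintype.card F : ℂ) - 1) * dwW T c a b =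
      dwP T ψ c a b 0 d + if T ^ a = 1 ∧ T ^ b = 1 ∧ T ^ d = 1 then
        ((Fintype.card F : ℂ) - 1) ^ 4 / (Fintype.card F : ℂ) else 0 := by
    intro a b d h
    rw [hT.W_eq c a b d h, dw_R_eq_P hψ c a b d h]
  have t0 : T ^ (0 : ℕ) = 1 := pow_zero T
  have t4 := hT.t4
  have t8 : T ^ 8 = 1 := by rw [show 8 = 4 * 2 by norm_num, pow_mul, t4, one_pow]
  have n1 : T ^ 1 ≠ 1 := by rw [pow_one]; exact hT.t1
  have n2 := hT.t2
  have n3 := hT.t3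
  have s1 : dwP T ψ c 0 1 1 2 = dwP T ψ c 0 0 1 3 := by
    rw [hT.P_shift c 0 0 1 3, ← hT.P_red (c : F) 0 1 1 2]
    unfold dwP
    exact Finset.sum_congr rfl fun A _ => by ring
  have s2 : dwP T ψ c 0 2 3 3 = dwP T ψ c 0 0 1 3 := by
    rw [hT.P_shift c 0 2 3 3, ← hT.P_red (c : F) 0 0 1 3]
    have := hT.P_red (ψ := ψ) (c : F) 0 4 1 3
    have e1 : dwP T ψ c (0 + 4) 0 1 3 = dwP T ψ c 0 4 1 3 := dwP_swap12 _ _ _ _ _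
    rw [e1, ← this]
    unfold dwP
    exact Finset.sum_congr rfl fun A _ => by ring
  have k00 := key 0 0 0 t0
  have k01 := key 0 1 3 t4
  have k02 := key 0 2 2 t4
  have k03 := key 0 3 1 t4
  have k10 := key 1 0 3 t4
  have k11 := key 1 1 2 t4
  have k12 := key 1 2 1 t4
  have k13 := key 1 3 0 t4
  have k20 := key 2 0 2 t4
  have k21 := key 2 1 1 t4
  have k22 := key 2 2 0 t4
  have k23 := key 2 3 3 t8
  have k30 := key 3 0 1 t4
  have k31 := key 3 1 0 t4
  have k32 := key 3 2 3 t8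
  have k33 := key 3 3 2 t8
  simp only [t0, n1, n2, n3, and_true, and_false, false_and, true_and, if_true, if_false,
    add_zero] at k00 k01 k02 k03 k10 k11 k12 k13 k20 k21 k22 k23 k30 k31 k32 k33
  have p1 : ∀ i j k l i' j' k' l' : ℕ, (∀ x : ℕ → ℂ, x i * x j * x k * x l = x i' * x j' * x k' * x l') →
      dwP T ψ c i j k l = dwP T ψ c i' j' k' l' := by
    intro i j k l i' j' k' l' h
    unfold dwP
    exact Finset.sum_congr rfl fun A _ => by rw [h (fun n => gaussSum (A * T ^ n) ψ)]
  rw [p1 0 1 0 3 0 0 1 3 (fun x => by ring)] at k01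
  rw [p1 0 2 0 2 0 0 2 2 (fun x => by ring)] at k02
  rw [p1 0 3 0 1 0 0 1 3 (fun x => by ring)] at k03
  rw [p1 1 0 0 3 0 0 1 3 (fun x => by ring)] at k10
  rw [p1 1 1 0 2 0 1 1 2 (fun x => by ring), s1] at k11
  rw [p1 1 2 0 1 0 1 1 2 (fun x => by ring), s1] at k12
  rw [p1 1 3 0 0 0 0 1 3 (fun x => by ring)] at k13
  rw [p1 2 0 0 2 0 0 2 2 (fun x => by ring)] at k20
  rw [p1 2 1 0 1 0 1 1 2 (fun x => by ring), s1] at k21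
  rw [p1 2 2 0 0 0 0 2 2 (fun x => by ring)] at k22
  rw [p1 2 3 0 3 0 2 3 3 (fun x => by ring), s2] at k23
  rw [p1 3 0 0 1 0 0 1 3 (fun x => by ring)] at k30
  rw [p1 3 1 0 0 0 0 1 3 (fun x => by ring)] at k31
  rw [p1 3 2 0 3 0 2 3 3 (fun x => by ring), s2] at k32
  rw [p1 3 3 0 2 0 2 3 3 (fun x => by ring), s2] at k33
  simp only [Finset.sum_range_succ, Finset.sum_range_zero, k00, k01, k02, k03, k10, k11, k12,
    k13, k20, k21, k22, k23, k30, k31, k32, k33]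
  ring

lemma dw_mkQ (ω : MulChar F ℂ) (hω : ∀ χ : MulChar F ℂ, ∃ j : ℕ, χ = ω ^ j) (t : ℕ)
    (ht : Fintype.card F = 4 * t + 1) : DwQ (ω ^ t) := by
  have ho := dw_orderOf ω hω
  have ho' : orderOf ω = 4 * t := by omega
  have ht0 : 0 < t := by
    rcases Nat.eq_zero_or_pos t with h | h
    · have := Fintype.one_lt_card (α := F)
      omega
    · exact h
  refine ⟨?_, ?_, ?_, ?_⟩
  · intro h2
    have hr : ringChar F = 2 := by
      have h3 : ringChar F ∣ 2 := ringChar.dvd (by exact_mod_cast h2)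
      rcases (Nat.dvd_prime Nat.prime_two).mp h3 with h | h
      · exact absurd h (CharP.ringChar_ne_one)
      · exact h
    have := FiniteField.even_card_of_char_two hr
    omega
  · rw [← pow_mul, ← orderOf_dvd_iff_pow_eq_one, ho']
    exact ⟨1, by ring⟩
  · rw [← pow_mul, Ne, ← orderOf_dvd_iff_pow_eq_one, ho']
    intro h
    have := Nat.le_of_dvd (by omega) h
    omega
  · intro A hA
    obtain ⟨j, rfl⟩ := hω A
    rw [← pow_mul, ← orderOf_dvd_iff_pow_eq_one, ho'] at hA
    obtain ⟨k, hk⟩ := hA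
    have hj : j = t * k := by
      have : 4 * j = 4 * (t * k) := by rw [← mul_assoc, ← hk]; ring
      omega
    have h4 : (ω ^ t) ^ 4 = 1 := by
      rw [← pow_mul, ← orderOf_dvd_iff_pow_eq_one, ho']
      exact ⟨1, by ring⟩
    have hk4 : ω ^ j = (ω ^ t) ^ (k % 4) := by
      rw [hj, pow_mul, pow_eq_pow_mod k h4]
    rw [hk4]
    have : k % 4 < 4 := Nat.mod_lt _ (by norm_num)
    interval_cases k % 4 <;> simp

end DworkHelpersG

/-- Goodson's formula for the number of rational points on the Dwork hypersurface of
degree four. -/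
theorem dwork_four_point_count (p e q t : ℕ) [Fact p.Prime] (F : Type) [Field F] [Fintype F]
    (he : 0 < e) (hq : q = Fintype.card F) (hqe : q = p ^ e) (hmod : q % 4 = 1)
    (ht : t = (q - 1) / 4)
    (ω : MulChar F ℂ) (hω : ∀ χ : MulChar F ℂ, ∃ j : ℕ, χ = ω ^ j)
    (lam : F) (hlam : lam ≠ 0) (hlam4 : lam ^ 4 ≠ 1) :
    (dworkCount F 4 lam : ℂ) =
      ((q : ℂ) ^ 3 - 1) / ((q : ℂ) - 1) +
      12 * (q : ℂ) * (ω ^ t) (-1) * (ω ^ (2 * t)) (1 - lam ^ 4) +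
      (q : ℂ) ^ 2 * greeneF F ω ![ω ^ t, ω ^ (2 * t), ω ^ (3 * t)] ![1, 1] (lam ^ 4)⁻¹ +
      3 * (q : ℂ) ^ 2 * gBinom F (ω ^ (3 * t)) (ω ^ t) *
        greene2F1 F (ω ^ (3 * t)) (ω ^ t) (ω ^ (2 * t)) (lam ^ 4)⁻¹ := by
  have hT : DwQ (ω ^ t) := dw_mkQ ω hω t (by omega)
  subst hq
  rw [mul_comm 2 t, mul_comm 3 t, pow_mul, pow_mul]
  generalize ω ^ t = T at hT ⊢
  obtain ⟨ψ, hψ⟩ := dw_exists_primitive (F := F)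
  have h4 : (4 : F) ≠ 0 := by
    rw [show (4 : F) = 2 * 2 by norm_num]; exact mul_ne_zero hT.two hT.two
  obtain ⟨l, rfl⟩ : ∃ l : Fˣ, (l : F) = lam := ⟨Units.mk0 lam hlam, rfl⟩
  obtain ⟨c, hc⟩ : ∃ c : Fˣ, (c : F) = 4 * l := ⟨Units.mk0 (4 * (l : F)) (mul_ne_zero h4 hlam), rfl⟩
  have hcount := dw_count_split (l : F)
  rw [← hc, hT.A4 hψ c, hT.A3, hT.A2, dw_P0 hψ c, hT.P13 hψ l c hc, hT.P2 hψ l c hc,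
    ← hT.greene3 hψ l c hc ω hω, ← dw_greene2 hT l, ← Finset.mul_sum, dw_phi_sum hT l] at hcount
  have hq := dw_card_ne_zero (F := F)
  have hq1 := dw_card_sub_one_ne_zero (F := F)
  apply mul_right_cancel₀ hq1
  rw [hcount]
  field_simp
  ring
end

section
/- Let q = p^e be a power of a prime with q ≡ 1 (mod 6), t = (q-1)/6, ω₂ = ω^{3t}, and let λ ∈ 𝔽_q with λ ≠ 0 and λ⁶ ≠ 1. For the equivalence class of w = (0,0,1,2,4,5): Σ_{w'∈[0,0,1,2,4,5]} N_q(0,w') + S_{[0,0,1,2,4,5]} = q²·ω₂(1-λ⁶). -/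
open scoped Classical

namespace HD
open Polynomial Finset

set_option linter.unusedSectionVars false
section count
variable {F : Type} [Field F] [Fintype F]

local notation "LL" => AlgebraicClosure F
local notation "qq" => Fintype.card F

noncomputable def rr (z : AlgebraicClosure F) : F :=
  Function.invFun (algebraMap F (AlgebraicClosure F)) z

lemma rr_alg (a : F) : rr (algebraMap F LL a) = a :=
  Function.leftInverse_invFun (algebraMap F LL).injective a

lemma mem_fixed {z : LL} (hz : z ^ qq = z) : ∃ a : F, algebraMap F LL a = z := by
  have h1 : (X ^ qq - X : F[X]) = ∏ a : F, (X - C a) := by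
    have hm : (X ^ qq - X : F[X]).Monic :=
      monic_X_pow_sub (by rw [degree_X]; exact_mod_cast Fintype.one_lt_card)
    have hr := FiniteField.roots_X_pow_card_sub_X F
    have := (prod_multiset_X_sub_C_of_monic_of_roots_card_eq hm (by
      rw [hr, FiniteField.X_pow_card_sub_X_natDegree_eq _ Fintype.one_lt_card]; rfl)).symm
    rw [hr] at this
    exact this
  have h2 : aeval z (X ^ qq - X : F[X]) = 0 := by simp [hz]
  rw [h1, map_prod, prod_eq_zero_iff] at h2
  obtain ⟨a, -, ha⟩ := h2
  exact ⟨a, (sub_eq_zero.mp (show z - algebraMap F LL a = 0 by simpa using ha)).symm⟩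

lemma alg_rr {z : LL} (hz : z ^ qq = z) : algebraMap F LL (rr z) = z := by
  obtain ⟨a, rfl⟩ := mem_fixed hz
  rw [rr_alg]

noncomputable def BB (F : Type) [Field F] [Fintype F] (k : ℕ) : Finset (AlgebraicClosure F) :=
  (X ^ (Fintype.card F ^ k) - X : (AlgebraicClosure F)[X]).roots.toFinset

lemma mem_BB {k : ℕ} (hk : k ≠ 0) (y : LL) : y ∈ BB F k ↔ y ^ (qq ^ k) = y := by
  have : (X ^ (qq ^ k) - X : LL[X]) ≠ 0 :=
    FiniteField.X_pow_card_pow_sub_X_ne_zero _ hk Fintype.one_lt_card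
  simp [BB, this, sub_eq_zero]

noncomputable def PP {n : ℕ} (y : Fin n → AlgebraicClosure F) : (AlgebraicClosure F)[X] :=
  ∏ i, (X - C (y i))

lemma PP_comp {n : ℕ} (y : Fin n → LL) (σ : Equiv.Perm (Fin n)) : PP (fun i => y (σ i)) = PP y :=
  Equiv.prod_comp σ (fun i => X - C (y i))

lemma PP_perm {n : ℕ} (y z : Fin n → LL) (h : PP y = PP z) :
    ∃ σ : Equiv.Perm (Fin n), z = fun i => y (σ i) := by
  have hr : ∀ w : Fin n → LL, (PP w).roots = (univ.val : Multiset (Fin n)).map w := by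
    intro w
    have := Polynomial.roots_multiset_prod_X_sub_C ((univ.val : Multiset (Fin n)).map w)
    rw [← this]
    rw [Multiset.map_map]; rfl
  have h1 : (univ.val : Multiset (Fin n)).map z = (univ.val : Multiset (Fin n)).map y := by
    rw [← hr, ← hr, h]
  have h2 : ∀ a : LL, Fintype.card {i // z i = a} = Fintype.card {i // y i = a} := by
    intro a
    have := congrArg (Multiset.count a) h1
    rw [Multiset.count_map, Multiset.count_map] at this
    rw [Fintype.card_subtype, Fintype.card_subtype]
    simpa [Finset.card, Finset.filter, eq_comm] using this
  have e : ∀ a : LL, Nonempty ({i // z i = a} ≃ {i // y i = a}) := fun a =>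
    Fintype.card_eq.mp (h2 a)
  replace e := fun a => (e a).some
  refine ⟨(Equiv.sigmaFiberEquiv z).symm.trans
    ((Equiv.sigmaCongrRight e).trans (Equiv.sigmaFiberEquiv y)), ?_⟩
  funext i
  exact ((e (z i)) ⟨i, rfl⟩).2.symm

lemma map_PP {n : ℕ} (y : Fin n → LL) :
    (PP y).map (FiniteField.frobeniusAlgHom F LL).toRingHom = PP (fun i => y i ^ qq) := by
  simp [PP, Polynomial.map_prod]

noncomputable def AA (F : Type) [Field F] [Fintype F] {n : ℕ} (σ : Equiv.Perm (Fin n)) :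
    Finset (Fin n → AlgebraicClosure F) :=
  (Fintype.piFinset fun _ : Fin n => BB F 6).filter
    (fun y => ∀ i, y i ^ Fintype.card F = y (σ i))

lemma pow_iter {n : ℕ} (σ : Equiv.Perm (Fin n)) (y : Fin n → LL)
    (h : ∀ i, y i ^ qq = y (σ i)) (k : ℕ) (i : Fin n) : y i ^ (qq ^ k) = y ((σ ^ k) i) := by
  induction k generalizing i with
  | zero => simp
  | succ k ih => rw [pow_succ', pow_mul, h, ih, pow_succ, Equiv.Perm.mul_apply]

lemma mem_AA {n : ℕ} (σ : Equiv.Perm (Fin n)) (h6 : σ ^ 6 = 1) (y : Fin n → LL) :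
    y ∈ AA F σ ↔ ∀ i, y i ^ qq = y (σ i) := by
  simp only [AA, mem_filter, Fintype.mem_piFinset, and_iff_right_iff_imp]
  intro h i
  rw [mem_BB (by norm_num), pow_iter σ y h, h6]; rfl

lemma count_main {n : ℕ} (h6 : ∀ σ : Equiv.Perm (Fin n), σ ^ 6 = 1) (f : F[X]) (hf : f.Monic)
    (hd : f.natDegree = n) :
    ∑ σ : Equiv.Perm (Fin n), #{y ∈ AA F σ | PP y = f.map (algebraMap F LL)} = n.factorial := by
  obtain ⟨y0, hy0⟩ : ∃ y : Fin n → LL, PP y = f.map (algebraMap F LL) := by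
    have hs := IsAlgClosed.splits (f.map (algebraMap F LL))
    have h1 := hs.eq_prod_roots_of_monic (hf.map _)
    have h2 : Multiset.card (f.map (algebraMap F LL)).roots = n := by
      rw [← hs.natDegree_eq_card_roots, natDegree_map, hd]
    obtain ⟨l, hl⟩ := Quot.exists_rep (f.map (algebraMap F LL)).roots
    have hl' : (l : Multiset LL) = (f.map (algebraMap F LL)).roots := hl
    rw [← hl'] at h1 h2
    rw [Multiset.coe_card] at h2
    subst h2
    refine ⟨l.get, ?_⟩
    rw [h1, PP]
    simp only [Multiset.map_coe, Multiset.prod_coe]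
    rw [← List.prod_ofFn]
    congr 1
    apply List.ext_get <;> simp
  set Xf : Finset (Fin n → LL) := univ.image (fun σ : Equiv.Perm (Fin n) => fun i => y0 (σ i))
  have hX : ∀ y, y ∈ Xf ↔ PP y = f.map (algebraMap F LL) := by
    intro y
    simp only [Xf, mem_image, mem_univ, true_and]
    constructor
    · rintro ⟨σ, rfl⟩; rw [PP_comp, hy0]
    · intro h
      obtain ⟨σ, hσ⟩ := PP_perm y0 y (by rw [h, hy0])
      exact ⟨σ, hσ.symm⟩
  have e1 : ∀ σ : Equiv.Perm (Fin n), {y ∈ AA F σ | PP y = f.map (algebraMap F LL)} =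
      {y ∈ Xf | ∀ i, y i ^ qq = y (σ i)} := by
    intro σ; ext y
    rw [mem_filter, mem_filter, mem_AA σ (h6 σ), hX, and_comm]
  simp_rw [e1]
  have e2 := Finset.sum_card_bipartiteAbove_eq_sum_card_bipartiteBelow (s := (univ : Finset (Equiv.Perm (Fin n)))) (t := Xf) (fun σ y => ∀ i, y i ^ qq = y (σ i))
  simp only [bipartiteAbove, bipartiteBelow] at e2
  rw [e2]
  have e3 : ∀ y ∈ Xf, #{σ : Equiv.Perm (Fin n) | ∀ i, y i ^ qq = y (σ i)} =
      #{σ : Equiv.Perm (Fin n) | (fun i => y0 (σ i)) = y} := by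
    intro y hy
    obtain ⟨τ, -, hτ⟩ := mem_image.mp hy
    have hphi : PP (fun i => y i ^ qq) = PP y := by
      rw [← map_PP, (hX y).mp hy, Polynomial.map_map]
      congr 1
      exact (FiniteField.frobeniusAlgHom F LL).comp_algebraMap
    obtain ⟨π, hπ⟩ := PP_perm y _ hphi.symm
    have hπ' : ∀ i, y i ^ qq = y (π i) := fun i => congrFun hπ i
    have hy' : ∀ i, y i = y0 (τ i) := fun i => (congrFun hτ i).symm
    refine card_bij' (fun σ _ => τ * σ * π⁻¹) (fun σ _ => τ⁻¹ * σ * π) ?_ ?_ ?_ ?_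
    · intro σ hσ
      simp only [mem_filter, mem_univ, true_and] at hσ ⊢
      funext i
      have := hσ (π⁻¹ i)
      rw [hπ'] at this
      simp only [Equiv.Perm.mul_apply]
      rw [← hy', ← this]; simp
    · intro σ hσ
      simp only [mem_filter, mem_univ, true_and] at hσ ⊢
      intro i
      rw [hπ', ← congrFun hσ (π i), hy']
      simp [Equiv.Perm.mul_apply]
    · intro σ _; simp [mul_assoc]
    · intro σ _; simp [mul_assoc]
  rw [sum_congr rfl e3, ← card_eq_sum_card_image]
  simp [Fintype.card_perm]

noncomputable def cf {n : ℕ} (y : Fin n → AlgebraicClosure F) : Fin n → F :=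
  fun i => rr ((PP y).coeff i)

noncomputable def polyOf {n : ℕ} (c : Fin n → F) : F[X] := X ^ n + ∑ i : Fin n, C (c i) * X ^ (i : ℕ)

lemma polyOf_deg {n : ℕ} (c : Fin n → F) : (∑ i : Fin n, C (c i) * X ^ (i : ℕ)).degree < (n : WithBot ℕ) :=
  Polynomial.degree_sum_fin_lt c

lemma polyOf_monic {n : ℕ} (c : Fin n → F) : (polyOf c).Monic :=
  monic_X_pow_add (polyOf_deg c)

lemma polyOf_natDegree {n : ℕ} (c : Fin n → F) : (polyOf c).natDegree = n := by
  apply natDegree_eq_of_degree_eq_some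
  rw [polyOf, degree_add_eq_left_of_degree_lt] <;> rw [degree_X_pow]
  exact polyOf_deg c

lemma polyOf_coeff {n : ℕ} (c : Fin n → F) (i : Fin n) : (polyOf c).coeff i = c i := by
  simp [polyOf, coeff_X_pow, coeff_C_mul, i.2.ne, Fin.val_inj]

lemma coeff_fixed {n : ℕ} (σ : Equiv.Perm (Fin n)) (y : Fin n → LL)
    (h : ∀ i, y i ^ qq = y (σ i)) (k : ℕ) : ((PP y).coeff k) ^ qq = (PP y).coeff k := by
  have h1 : (PP y).map (FiniteField.frobeniusAlgHom F LL).toRingHom = PP y := by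
    rw [map_PP]; simp_rw [h]; exact PP_comp y σ
  have := congrArg (fun p => coeff p k) h1
  simpa [coeff_map] using this

lemma PP_monic {n : ℕ} (y : Fin n → LL) : (PP y).Monic := monic_prod_X_sub_C _ _
lemma PP_natDegree {n : ℕ} (y : Fin n → LL) : (PP y).natDegree = n := by
  simp [PP, natDegree_prod_of_monic, monic_X_sub_C]

lemma sum_main {n : ℕ} (h6 : ∀ σ : Equiv.Perm (Fin n), σ ^ 6 = 1) (η : (Fin n → F) → ℂ) :
    ∑ σ : Equiv.Perm (Fin n), ∑ y ∈ AA F σ, η (cf y) = n.factorial * ∑ c, η c := by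
  have h1 : ∀ (σ : Equiv.Perm (Fin n)) (c : Fin n → F), {y ∈ AA F σ | cf y = c} =
      {y ∈ AA F σ | PP y = (polyOf c).map (algebraMap F LL)} := by
    intro σ c
    apply filter_congr
    intro y hy
    rw [mem_AA σ (h6 σ)] at hy
    constructor
    · rintro rfl
      ext k
      rw [coeff_map]
      rcases lt_trichotomy k n with hk | hk | hk
      · have := polyOf_coeff (cf y) ⟨k, hk⟩
        simp only at this
        rw [this, cf, alg_rr (coeff_fixed σ y hy _)]
      · have a := PP_monic y
        have b := polyOf_monic (cf y)
        rw [Monic, leadingCoeff, PP_natDegree] at a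
        rw [Monic, leadingCoeff, polyOf_natDegree] at b
        rw [hk, a, b, map_one]
      · rw [coeff_eq_zero_of_natDegree_lt (by rwa [PP_natDegree]),
          coeff_eq_zero_of_natDegree_lt (by rwa [polyOf_natDegree]), map_zero]
    · intro h
      funext i
      rw [cf, h, coeff_map, rr_alg, polyOf_coeff]
  have h2 : ∀ σ : Equiv.Perm (Fin n), ∑ y ∈ AA F σ, η (cf y) =
      ∑ c : Fin n → F, (#{y ∈ AA F σ | PP y = (polyOf c).map (algebraMap F LL)} : ℂ) * η c := by
    intro σ
    rw [← Finset.sum_fiberwise (AA F σ) (fun y => cf y)]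
    refine sum_congr rfl fun c _ => ?_
    rw [← h1, sum_congr rfl (g := fun _ => η c)]
    · simp
    · intro y hy; rw [(mem_filter.mp hy).2]
  simp_rw [h2]
  rw [sum_comm, mul_sum]
  refine sum_congr rfl fun c _ => ?_
  rw [← sum_mul, ← count_main h6 (polyOf c) (polyOf_monic c) (polyOf_natDegree c)]
  push_cast; rfl

end count
end HD
namespace HD
open Polynomial Finset
set_option linter.unusedSectionVars false
section sums
variable {F : Type} [Field F] [Fintype F]

local notation "LL" => AlgebraicClosure F
local notation "qq" => Fintype.card F

lemma add_q (z w : LL) : (z + w) ^ qq = z ^ qq + w ^ qq :=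
  map_add (FiniteField.frobeniusAlgHom F LL) z w

lemma sum_q {ι : Type} (s : Finset ι) (f : ι → LL) : (∑ i ∈ s, f i) ^ qq = ∑ i ∈ s, f i ^ qq :=
  map_sum (FiniteField.frobeniusAlgHom F LL) f s

lemma rr_mul {z w : LL} (hz : z ^ qq = z) (hw : w ^ qq = w) : rr (z * w) = rr z * rr w := by
  obtain ⟨a, rfl⟩ := mem_fixed hz
  obtain ⟨b, rfl⟩ := mem_fixed hw
  rw [← map_mul, rr_alg, rr_alg, rr_alg]

lemma rr_add {z w : LL} (hz : z ^ qq = z) (hw : w ^ qq = w) : rr (z + w) = rr z + rr w := by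
  obtain ⟨a, rfl⟩ := mem_fixed hz
  obtain ⟨b, rfl⟩ := mem_fixed hw
  rw [← map_add, rr_alg, rr_alg, rr_alg]

noncomputable def NN (k : ℕ) (z : AlgebraicClosure F) : AlgebraicClosure F :=
  z ^ (∑ i ∈ range k, Fintype.card F ^ i)
noncomputable def TT (k : ℕ) (z : AlgebraicClosure F) : AlgebraicClosure F :=
  ∑ i ∈ range k, z ^ (Fintype.card F ^ i)

lemma NN_fixed {k : ℕ} {z : LL} (hz : z ^ (qq ^ k) = z) : (NN k z) ^ qq = NN k z := by
  by_cases h0 : z = 0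
  · subst h0
    rw [NN]
    by_cases h : (∑ i ∈ range k, Fintype.card F ^ i) = 0
    · rw [h]; simp
    · rw [zero_pow h, zero_pow Fintype.card_ne_zero]
  · have h1 : (∑ i ∈ range k, Fintype.card F ^ i) * qq + 1 =
        (∑ i ∈ range k, Fintype.card F ^ i) + qq ^ k := by
      rw [← sum_range_succ, sum_range_succ', sum_mul]
      simp [pow_succ]
    apply mul_right_cancel₀ h0
    rw [NN, ← pow_mul, ← pow_succ, h1, pow_add, hz]

lemma TT_fixed {k : ℕ} {z : LL} (hz : z ^ (qq ^ k) = z) : (TT k z) ^ qq = TT k z := by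
  rw [TT, sum_q]
  have : ∑ i ∈ range k, (z ^ qq ^ i) ^ qq + z = ∑ i ∈ range k, z ^ qq ^ i + z := by
    have h := sum_range_succ (fun i => z ^ qq ^ i) k
    rw [sum_range_succ'] at h
    simp only [pow_zero, pow_one, hz] at h
    rw [← h]
    simp only [pow_succ, pow_mul]
  exact add_right_cancel this

lemma NN_ne {k : ℕ} {z : LL} (hz : z ≠ 0) : NN k z ≠ 0 := pow_ne_zero _ hz

noncomputable def hh (k : ℕ) (χ : MulChar F ℂ) (ψ : AddChar F ℂ) (z : AlgebraicClosure F) : ℂ :=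
  χ (rr (NN k z)) * ψ (rr (TT k z))

noncomputable def SS (m k : ℕ) (χ : MulChar F ℂ) (ψ : AddChar F ℂ) : ℂ :=
  ∑ y ∈ BB F k, hh k χ ψ (y ^ m)

noncomputable def gg {n : ℕ} (m : ℕ) (χ : MulChar F ℂ) (ψ : AddChar F ℂ)
    (y : Fin n → AlgebraicClosure F) : ℂ :=
  χ (rr (∏ i, y i ^ m)) * ψ (rr (∑ i, y i ^ m))

lemma split_term (χ : MulChar F ℂ) (ψ : AddChar F ℂ) {a b c d : LL} (ha : a ^ qq = a)
    (hb : b ^ qq = b) (hc : c ^ qq = c) (hd : d ^ qq = d) :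
    χ (rr (a * b)) * ψ (rr (c + d)) = (χ (rr a) * ψ (rr c)) * (χ (rr b) * ψ (rr d)) := by
  rw [rr_mul ha hb, rr_add hc hd, map_mul, AddChar.map_add_eq_mul]; ring

lemma powm {k : ℕ} {z : LL} (m : ℕ) (hz : z ^ (qq ^ k) = z) : (z ^ m) ^ (qq ^ k) = z ^ m := by
  rw [← pow_mul, mul_comm, pow_mul, hz]

lemma NN1 (z : LL) : NN 1 z = z := by simp [NN]
lemma NN2 (z : LL) : NN 2 z = z * z ^ qq := by simp [NN, sum_range_succ, pow_add]
lemma NN3 (z : LL) : NN 3 z = z * z ^ qq * z ^ (qq ^ 2) := by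
  simp [NN, sum_range_succ, pow_add]
lemma TT1 (z : LL) : TT 1 z = z := by simp [TT]
lemma TT2 (z : LL) : TT 2 z = z + z ^ qq := by simp [TT, sum_range_succ]
lemma TT3 (z : LL) : TT 3 z = z + z ^ qq + z ^ (qq ^ 2) := by
  simp [TT, sum_range_succ]

lemma pair_sum (m : ℕ) (χ : MulChar F ℂ) (ψ : AddChar F ℂ) :
    ∑ σ : Equiv.Perm (Fin 2), ∑ y ∈ AA F σ, gg m χ ψ y = SS m 1 χ ψ ^ 2 + SS m 2 χ ψ := by
  have hu : (univ : Finset (Equiv.Perm (Fin 2))) = {1, Equiv.swap 0 1} := by decide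
  rw [hu, sum_pair (by decide)]
  congr 1
  · rw [sq, SS, sum_mul_sum, ← sum_product']
    refine sum_bij' (fun y _ => (y 0, y 1)) (fun x _ => ![x.1, x.2]) ?_ ?_ ?_ ?_ ?_
    · intro y hy
      rw [mem_AA _ (by decide)] at hy
      simp only [mem_product, mem_BB one_ne_zero, pow_one]
      exact ⟨hy 0, hy 1⟩
    · intro x hx
      simp only [mem_product, mem_BB one_ne_zero, pow_one] at hx
      rw [mem_AA _ (by decide)]
      simp [Fin.forall_fin_two, hx]
    · intro y _; funext i; fin_cases i <;> rfl
    · intro x _; rfl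
    · intro y hy
      rw [mem_AA _ (by decide)] at hy
      have h0 : (y 0 ^ m) ^ qq = y 0 ^ m := by simpa using powm (k := 1) m (by simpa using hy 0)
      have h1 : (y 1 ^ m) ^ qq = y 1 ^ m := by simpa using powm (k := 1) m (by simpa using hy 1)
      simp only [gg, hh, Fin.prod_univ_two, Fin.sum_univ_two, NN1, TT1]
      exact split_term χ ψ h0 h1 h0 h1
  · rw [SS]
    refine sum_bij' (fun y _ => y 0) (fun x _ => ![x, x ^ qq]) ?_ ?_ ?_ ?_ ?_
    · intro y hy
      rw [mem_AA _ (by decide)] at hy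
      rw [mem_BB two_ne_zero, pow_iter _ _ hy]
      exact congrArg y (by decide)
    · intro x hx
      rw [mem_BB two_ne_zero] at hx
      rw [mem_AA _ (by decide)]
      simp [Fin.forall_fin_two, ← pow_mul, ← sq, hx]
    · intro y hy
      rw [mem_AA _ (by decide)] at hy
      funext i; fin_cases i
      · rfl
      · simpa using hy 0
    · intro x _; rfl
    · intro y hy
      rw [mem_AA _ (by decide)] at hy
      have h0 : y 0 ^ qq = y 1 := by simpa using hy 0
      have h1 : (y 0 ^ m) ^ qq = y 1 ^ m := by rw [← h0, ← pow_mul, ← pow_mul, mul_comm]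
      simp only [gg, hh, Fin.prod_univ_two, Fin.sum_univ_two, NN2, TT2, h1]

lemma triple_id (m : ℕ) (χ : MulChar F ℂ) (ψ : AddChar F ℂ) :
    ∑ y ∈ AA F (1 : Equiv.Perm (Fin 3)), gg m χ ψ y = SS m 1 χ ψ ^ 3 := by
  have : SS m 1 χ ψ ^ 3 = ∑ x ∈ BB F 1 ×ˢ BB F 1 ×ˢ BB F 1,
      hh 1 χ ψ (x.1 ^ m) * (hh 1 χ ψ (x.2.1 ^ m) * hh 1 χ ψ (x.2.2 ^ m)) := by
    rw [pow_succ', sq, SS, sum_mul_sum, ← sum_product', sum_mul_sum, ← sum_product']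
  rw [this]
  refine sum_bij' (fun y _ => (y 0, y 1, y 2)) (fun x _ => ![x.1, x.2.1, x.2.2]) ?_ ?_ ?_ ?_ ?_
  · intro y hy
    rw [mem_AA _ (by decide)] at hy
    simp only [mem_product, mem_BB one_ne_zero, pow_one]
    exact ⟨hy 0, hy 1, hy 2⟩
  · intro x hx
    simp only [mem_product, mem_BB one_ne_zero, pow_one] at hx
    rw [mem_AA _ (by decide)]
    intro i; fin_cases i <;> simp [hx]
  · intro y _; funext i; fin_cases i <;> rfl
  · intro x _; rfl
  · intro y hy
    rw [mem_AA _ (by decide)] at hy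
    have h0 : (y 0 ^ m) ^ qq = y 0 ^ m := by simpa using powm (k := 1) m (by simpa using hy 0)
    have h1 : (y 1 ^ m) ^ qq = y 1 ^ m := by simpa using powm (k := 1) m (by simpa using hy 1)
    have h2 : (y 2 ^ m) ^ qq = y 2 ^ m := by simpa using powm (k := 1) m (by simpa using hy 2)
    simp only [gg, hh, Fin.prod_univ_three, Fin.sum_univ_three, NN1, TT1, mul_assoc, add_assoc]
    rw [split_term χ ψ h0 (by rw [mul_pow, h1, h2]) h0 (by rw [add_q, h1, h2]),
      split_term χ ψ h1 h2 h1 h2]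
    ring

lemma univ_ijk {i j k : Fin 3} (hij : i ≠ j) (hik : i ≠ k) (hjk : j ≠ k) :
    (univ : Finset (Fin 3)) = {i, j, k} := by
  revert i j k; decide

lemma perm3_pow (σ : Equiv.Perm (Fin 3)) : σ ^ 6 = 1 := by
  have h : Fintype.card (Equiv.Perm (Fin 3)) = 6 := by rw [Fintype.card_perm]; rfl
  rw [← h]; exact pow_card_eq_one
lemma perm2_pow (σ : Equiv.Perm (Fin 2)) : σ ^ 6 = 1 := by revert σ; decide

lemma triple_swap (m : ℕ) (χ : MulChar F ℂ) (ψ : AddChar F ℂ) (σ : Equiv.Perm (Fin 3))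
    (i j k : Fin 3) (hij : i ≠ j) (hik : i ≠ k) (hjk : j ≠ k)
    (h1 : σ i = j) (h2 : σ j = i) (h3 : σ k = k) :
    ∑ y ∈ AA F σ, gg m χ ψ y = SS m 1 χ ψ * SS m 2 χ ψ := by
  have hu := univ_ijk hij hik hjk
  have h6 : σ ^ 6 = 1 := perm3_pow σ
  have hall : ∀ P : Fin 3 → Prop, (∀ l, P l) ↔ P i ∧ P j ∧ P k := by
    intro P
    refine ⟨fun h => ⟨h i, h j, h k⟩, fun h l => ?_⟩
    have : l ∈ ({i, j, k} : Finset (Fin 3)) := hu ▸ mem_univ l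
    simp only [mem_insert, mem_singleton] at this
    rcases this with rfl | rfl | rfl
    exacts [h.1, h.2.1, h.2.2]
  rw [SS, SS, sum_mul_sum, ← sum_product']
  refine sum_bij' (fun y _ => (y k, y i))
    (fun x _ => fun l => if l = k then x.1 else if l = i then x.2 else x.2 ^ qq) ?_ ?_ ?_ ?_ ?_
  · intro y hy
    rw [mem_AA _ h6] at hy
    simp only [mem_product, mem_BB one_ne_zero, mem_BB two_ne_zero, pow_one]
    refine ⟨by rw [hy k, h3], ?_⟩
    rw [sq, pow_mul, hy, h1, hy, h2]
  · intro x hx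
    simp only [mem_product, mem_BB one_ne_zero, mem_BB two_ne_zero, pow_one] at hx
    rw [mem_AA _ h6, hall, h1, h2, h3]
    simp [hij.symm, hik, hjk, hx.1, ← pow_mul, ← sq, hx.2]
  · intro y hy
    rw [mem_AA _ h6] at hy
    have a := hy i
    rw [h1] at a
    rw [funext_iff, hall]
    simp [hij.symm, hik, hjk, a]
  · intro x _; simp [hik]
  · intro y hy
    rw [mem_AA _ h6] at hy
    have a := hy i
    have b := hy j
    have c := hy k
    rw [h1] at a
    rw [h2] at b
    rw [h3] at c
    have h1 : (y i ^ m) ^ qq = y j ^ m := by rw [← a, ← pow_mul, ← pow_mul, mul_comm]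
    have h2 : (y j ^ m) ^ qq = y i ^ m := by rw [← b, ← pow_mul, ← pow_mul, mul_comm]
    have h3 : (y k ^ m) ^ qq = y k ^ m := by simpa using powm (k := 1) m (by simpa using c)
    have e1 : ∏ l, y l ^ m = y k ^ m * (y i ^ m * y j ^ m) := by
      rw [hu, prod_insert (by simp [hij, hik]), prod_pair hjk]; ring
    have e2 : ∑ l, y l ^ m = y k ^ m + (y i ^ m + y j ^ m) := by
      rw [hu, sum_insert (by simp [hij, hik]), sum_pair hjk]; ring
    simp only [gg, hh, e1, e2, NN1, TT1, NN2, TT2, h1]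
    exact split_term χ ψ h3 (by rw [mul_pow, h1, h2, mul_comm]) h3 (by rw [add_q, h1, h2, add_comm])

lemma triple_cyc (m : ℕ) (χ : MulChar F ℂ) (ψ : AddChar F ℂ) (σ : Equiv.Perm (Fin 3))
    (i j k : Fin 3) (hij : i ≠ j) (hik : i ≠ k) (hjk : j ≠ k)
    (h1 : σ i = j) (h2 : σ j = k) (h3 : σ k = i) :
    ∑ y ∈ AA F σ, gg m χ ψ y = SS m 3 χ ψ := by
  have hu := univ_ijk hij hik hjk
  have h6 : σ ^ 6 = 1 := perm3_pow σ
  have hall : ∀ P : Fin 3 → Prop, (∀ l, P l) ↔ P i ∧ P j ∧ P k := by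
    intro P
    refine ⟨fun h => ⟨h i, h j, h k⟩, fun h l => ?_⟩
    have : l ∈ ({i, j, k} : Finset (Fin 3)) := hu ▸ mem_univ l
    simp only [mem_insert, mem_singleton] at this
    rcases this with rfl | rfl | rfl
    exacts [h.1, h.2.1, h.2.2]
  rw [SS]
  refine sum_bij' (fun y _ => y i)
    (fun x _ => fun l => if l = i then x else if l = j then x ^ qq else (x ^ qq) ^ qq) ?_ ?_ ?_ ?_ ?_
  · intro y hy
    rw [mem_AA _ h6] at hy
    rw [mem_BB three_ne_zero, pow_succ, sq, pow_mul, pow_mul, hy, h1, hy, h2, hy, h3]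
  · intro x hx
    rw [mem_BB three_ne_zero, pow_succ, sq, pow_mul, pow_mul] at hx
    rw [mem_AA _ h6, hall, h1, h2, h3]
    simp [hij.symm, hik.symm, hjk.symm, hx]
  · intro y hy
    rw [mem_AA _ h6] at hy
    have a := hy i
    have b := hy j
    rw [h1] at a
    rw [h2] at b
    rw [funext_iff, hall]
    simp [hij.symm, hik.symm, hjk.symm, a, b]
  · intro x _; simp
  · intro y hy
    rw [mem_AA _ h6] at hy
    have a := hy i
    have b := hy j
    rw [h1] at a
    rw [h2] at b
    have h1 : (y i ^ m) ^ qq = y j ^ m := by rw [← a, ← pow_mul, ← pow_mul, mul_comm]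
    have h2 : (y j ^ m) ^ qq = y k ^ m := by rw [← b, ← pow_mul, ← pow_mul, mul_comm]
    have h4 : (y i ^ m) ^ qq ^ 2 = y k ^ m := by rw [sq, pow_mul, h1, h2]
    have e1 : ∏ l, y l ^ m = y i ^ m * y j ^ m * y k ^ m := by
      rw [hu, prod_insert (by simp [hij, hik]), prod_pair hjk]; ring
    have e2 : ∑ l, y l ^ m = y i ^ m + y j ^ m + y k ^ m := by
      rw [hu, sum_insert (by simp [hij, hik]), sum_pair hjk]; ring
    simp only [gg, hh, e1, e2, NN3, TT3, h1, h4]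

lemma triple_sum (m : ℕ) (χ : MulChar F ℂ) (ψ : AddChar F ℂ) :
    ∑ σ : Equiv.Perm (Fin 3), ∑ y ∈ AA F σ, gg m χ ψ y =
      SS m 1 χ ψ ^ 3 + 3 * (SS m 1 χ ψ * SS m 2 χ ψ) + 2 * SS m 3 χ ψ := by
  have hu : (univ : Finset (Equiv.Perm (Fin 3))) = {1, Equiv.swap 0 1, Equiv.swap 0 2,
    Equiv.swap 1 2, finRotate 3, (finRotate 3)⁻¹} := by decide
  rw [hu, sum_insert (by decide), sum_insert (by decide), sum_insert (by decide),
    sum_insert (by decide), sum_pair (by decide), triple_id,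
    triple_swap m χ ψ _ 0 1 2 (by decide) (by decide) (by decide) (by decide) (by decide) (by decide),
    triple_swap m χ ψ _ 0 2 1 (by decide) (by decide) (by decide) (by decide) (by decide) (by decide),
    triple_swap m χ ψ _ 1 2 0 (by decide) (by decide) (by decide) (by decide) (by decide) (by decide),
    triple_cyc m χ ψ _ 0 1 2 (by decide) (by decide) (by decide) (by decide) (by decide) (by decide),
    triple_cyc m χ ψ _ 0 2 1 (by decide) (by decide) (by decide) (by decide) (by decide) (by decide)]
  ring

end sums
end HD
namespace HD
open Polynomial Finset
set_option linter.unusedSectionVars false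
section cover
variable {F : Type} [Field F] [Fintype F]

local notation "LL" => AlgebraicClosure F
local notation "qq" => Fintype.card F

lemma exists_prim {m : ℕ} (hm : m ∣ qq - 1) : ∃ ζ : LL, IsPrimitiveRoot ζ m := by
  obtain ⟨g, hg⟩ := IsCyclic.exists_ofOrder_eq_natCard (α := Fˣ)
  rw [Nat.card_eq_fintype_card, Fintype.card_units] at hg
  have h1 : IsPrimitiveRoot g (qq - 1) := hg ▸ IsPrimitiveRoot.orderOf g
  have h2 : IsPrimitiveRoot (g : F) (qq - 1) := IsPrimitiveRoot.coe_units_iff.mpr h1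
  obtain ⟨d, hd⟩ := hm
  have h3 := h2.pow (by have := Fintype.one_lt_card (α := F); omega) (hd.trans (mul_comm _ _))
  exact ⟨_, h3.map_of_injective (algebraMap F LL).injective⟩

lemma card_fiber {m k : ℕ} (hm : m ∣ qq - 1) (hk : k ≠ 0) (ρ : MulChar F ℂ)
    (hρ : ρ ^ m = 1) (hρ' : ∀ a : F, a ≠ 0 → ρ a = 1 → a ^ ((qq - 1) / m) = 1)
    (z : LL) (hz : z ∈ BB F k) (hz0 : z ≠ 0) :
    (#{y ∈ BB F k | y ^ m = z} : ℂ) = ∑ i ∈ range m, (ρ ^ i) (rr (NN k z)) := by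
  rw [mem_BB hk] at hz
  have hq1 : 1 < qq := Fintype.one_lt_card
  have hm0 : m ≠ 0 := by rintro rfl; rw [zero_dvd_iff] at hm; omega
  have hNf := NN_fixed hz
  have hN : algebraMap F LL (rr (NN k z)) = NN k z := alg_rr hNf
  have hN0 : rr (NN k z) ≠ 0 := by
    intro h; rw [h, map_zero] at hN; exact NN_ne hz0 hN.symm
  have hpow : ∀ i, (ρ ^ i) (rr (NN k z)) = (ρ (rr (NN k z))) ^ i := by
    intro i
    have := MulChar.pow_apply_coe ρ i (Units.mk0 _ hN0)
    simpa using this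
  simp_rw [hpow]
  have hgeo : (∑ i ∈ range k, qq ^ i) * (qq - 1) + 1 = qq ^ k := by
    have := Nat.geomSum_eq hq1 k
    have h2 : (qq - 1) ∣ qq ^ k - 1 := by simpa using Nat.sub_dvd_pow_sub_pow qq 1 k
    rw [this, Nat.div_mul_cancel h2]
    have : 0 < qq ^ k := by positivity
    omega
  have hfix : ∀ y : LL, y ≠ 0 → (y ^ (qq ^ k) = y ↔ y ^ ((∑ i ∈ range k, qq ^ i) * (qq - 1)) = 1) := by
    intro y hy
    rw [← hgeo, pow_succ]
    constructor
    · intro h; exact mul_right_cancel₀ hy (by rw [h, one_mul])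
    · intro h; rw [h, one_mul]
  by_cases h1 : ρ (rr (NN k z)) = 1
  · have hp := hρ' _ hN0 h1
    have hp' : NN k z ^ ((qq - 1) / m) = 1 := by rw [← hN, ← map_pow, hp, map_one]
    obtain ⟨ζ, hζ⟩ := exists_prim (F := F) hm
    have hroots : {y ∈ BB F k | y ^ m = z} = (nthRoots m z).toFinset := by
      ext y
      rw [mem_filter, Multiset.mem_toFinset, mem_nthRoots (Nat.pos_of_ne_zero hm0), mem_BB hk,
        and_iff_right_iff_imp]
      intro hy
      have hy0 : y ≠ 0 := by rintro rfl; rw [zero_pow hm0] at hy; exact hz0 hy.symm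
      rw [hfix y hy0]
      rw [NN, ← hy, ← pow_mul, ← pow_mul] at hp'
      rw [← hp']
      congr 1
      obtain ⟨d, hd⟩ := hm
      rw [hd, Nat.mul_div_cancel_left _ (Nat.pos_of_ne_zero hm0)]
      ring
    rw [hroots, Multiset.toFinset_card_of_nodup (hζ.nthRoots_nodup hz0), hζ.card_nthRoots,
      if_pos (IsAlgClosed.exists_pow_nat_eq z (Nat.pos_of_ne_zero hm0)), h1]
    simp
  · have hs : ∑ i ∈ range m, (ρ (rr (NN k z))) ^ i = 0 := by
      rw [geom_sum_eq h1, ← hpow, hρ, MulChar.one_apply (isUnit_iff_ne_zero.mpr hN0)]; simp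
    rw [hs]
    have : {y ∈ BB F k | y ^ m = z} = ∅ := by
      rw [filter_eq_empty_iff]
      intro y hy h
      rw [mem_BB hk] at hy
      apply h1
      have e : NN k z = (NN k y) ^ m := by rw [NN, NN, ← h, ← pow_mul, ← pow_mul, mul_comm]
      have e2 : rr (NN k z) = rr (NN k y) ^ m := by
        apply (algebraMap F LL).injective
        rw [hN, map_pow, alg_rr (NN_fixed hy), e]
      have hb : rr (NN k y) ≠ 0 := by
        intro hb; rw [hb, zero_pow hm0] at e2; exact hN0 e2
      rw [e2, map_pow]
      have := MulChar.pow_apply_coe ρ m (Units.mk0 _ hb)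
      rw [hρ, MulChar.one_apply_coe] at this
      simpa using this.symm
    rw [this]; simp

lemma hh_zero {k : ℕ} (hk : k ≠ 0) (χ : MulChar F ℂ) (ψ : AddChar F ℂ) : hh k χ ψ 0 = 0 := by
  have h : (∑ i ∈ range k, qq ^ i) ≠ 0 := by
    obtain ⟨k, rfl⟩ := Nat.exists_eq_succ_of_ne_zero hk
    rw [sum_range_succ']; simp
  have h2 : rr (0 : LL) = 0 := by
    have := rr_alg (0 : F)
    rwa [map_zero] at this
  rw [hh, NN, zero_pow h, h2, MulChar.map_zero, zero_mul]

lemma SS_cover {m k : ℕ} (hm : m ∣ qq - 1) (hk : k ≠ 0) (T ρ : MulChar F ℂ) (ψ : AddChar F ℂ)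
    (hρ : ρ ^ m = 1) (hρ' : ∀ a : F, a ≠ 0 → ρ a = 1 → a ^ ((qq - 1) / m) = 1) :
    SS m k T ψ = ∑ i ∈ range m, SS 1 k (T * ρ ^ i) ψ := by
  have h1 : SS m k T ψ = ∑ z ∈ BB F k, (#{y ∈ BB F k | y ^ m = z} : ℂ) * hh k T ψ z := by
    rw [SS, ← sum_fiberwise_of_maps_to (s := BB F k) (t := BB F k) (g := fun y => y ^ m)]
    · refine sum_congr rfl fun z _ => ?_
      rw [sum_congr rfl (g := fun _ => hh k T ψ z)]
      · simp
      · intro y hy; rw [(mem_filter.mp hy).2]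
    · intro y hy
      rw [mem_BB hk] at hy ⊢
      exact powm m hy
  rw [h1]
  simp only [SS, pow_one]
  rw [sum_comm]
  refine sum_congr rfl fun z hz => ?_
  by_cases h0 : z = 0
  · subst h0; simp [hh_zero hk]
  · rw [card_fiber hm hk ρ hρ hρ' z hz h0, sum_mul]
    refine sum_congr rfl fun i _ => ?_
    rw [hh, hh, MulChar.mul_apply]; ring

lemma SS_one (χ : MulChar F ℂ) (ψ : AddChar F ℂ) : SS 1 1 χ ψ = gaussSum χ ψ := by
  rw [SS, gaussSum]
  symm
  refine sum_bij (fun a _ => algebraMap F LL a) ?_ ?_ ?_ ?_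
  · intro a _
    rw [mem_BB one_ne_zero, pow_one, ← map_pow, FiniteField.pow_card]
  · intro a _ b _ h; exact (algebraMap F LL).injective h
  · intro z hz
    rw [mem_BB one_ne_zero, pow_one] at hz
    obtain ⟨a, ha⟩ := mem_fixed hz
    exact ⟨a, mem_univ _, ha⟩
  · intro a _
    rw [hh, NN1, TT1, pow_one, rr_alg]

lemma alg_cf {n : ℕ} (σ : Equiv.Perm (Fin n)) (h6 : σ ^ 6 = 1) {y : Fin n → LL} (hy : y ∈ AA F σ)
    (i : Fin n) : algebraMap F LL (cf y i) = (PP y).coeff i := by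
  rw [mem_AA σ h6] at hy
  exact alg_rr (coeff_fixed σ y hy i)

lemma PP_two (y : Fin 2 → LL) : PP y = X ^ 2 - C (y 0 + y 1) * X + C (y 0 * y 1) := by
  simp only [PP, Fin.prod_univ_two, C_add, C_mul]; ring

lemma PP_three (y : Fin 3 → LL) : PP y = X ^ 3 - C (y 0 + y 1 + y 2) * X ^ 2 +
    C (y 0 * y 1 + y 0 * y 2 + y 1 * y 2) * X - C (y 0 * y 1 * y 2) := by
  simp only [PP, Fin.prod_univ_three, C_add, C_mul]; ring

lemma coeff_two (y : Fin 2 → LL) : (PP y).coeff 0 = y 0 * y 1 ∧ (PP y).coeff 1 = -(y 0 + y 1) := by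
  rw [PP_two]
  constructor
  · simp
  · simp only [coeff_add, coeff_sub, coeff_C_mul, coeff_X_pow, coeff_X, coeff_C]; simp

lemma coeff_three (y : Fin 3 → LL) : (PP y).coeff 0 = -(y 0 * y 1 * y 2) ∧
    (PP y).coeff 1 = y 0 * y 1 + y 0 * y 2 + y 1 * y 2 ∧ (PP y).coeff 2 = -(y 0 + y 1 + y 2) := by
  rw [PP_three]
  refine ⟨?_, ?_, ?_⟩ <;>
    simp only [coeff_add, coeff_sub, coeff_C_mul, coeff_X_pow, coeff_X, coeff_C] <;> simp

lemma gg_eq {n : ℕ} (m : ℕ) (χ : MulChar F ℂ) (ψ : AddChar F ℂ) (y : Fin n → LL) (a b : F)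
    (ha : ∏ i, y i ^ m = algebraMap F LL a) (hb : ∑ i, y i ^ m = algebraMap F LL b) :
    gg m χ ψ y = χ a * ψ b := by
  rw [gg, ha, hb, rr_alg, rr_alg]

lemma sum_fin2 (f : F → F → ℂ) : ∑ c : Fin 2 → F, f (c 0) (c 1) = ∑ a, ∑ b, f a b := by
  rw [← Fintype.sum_prod_type']
  exact Fintype.sum_equiv (finTwoArrowEquiv F) _ _ (fun c => rfl)

lemma sum_fin3 (f : F → F → F → ℂ) :
    ∑ c : Fin 3 → F, f (c 0) (c 1) (c 2) = ∑ a, ∑ b, ∑ c, f a b c := by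
  have : ∀ a, ∑ b, ∑ c, f a b c = ∑ x : F × F, f a x.1 x.2 := fun a => by
    rw [Fintype.sum_prod_type]
  simp_rw [this]
  rw [← Fintype.sum_prod_type' (f := fun a (x : F × F) => f a x.1 x.2)]
  refine Fintype.sum_equiv ⟨fun c => (c 0, c 1, c 2), fun x => ![x.1, x.2.1, x.2.2], ?_, ?_⟩ _ _
    (fun c => rfl)
  · intro c; funext i; fin_cases i <;> rfl
  · intro x; rfl

lemma two_one (χ : MulChar F ℂ) (ψ : AddChar F ℂ) (hψ : ψ ≠ 1) :
    SS 1 2 χ ψ = - gaussSum χ ψ ^ 2 := by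
  have h := sum_main (F := F) perm2_pow (fun c => χ (c 0) * ψ (-c 1))
  have h2 : ∑ σ : Equiv.Perm (Fin 2), ∑ y ∈ AA F σ, gg 1 χ ψ y = SS 1 1 χ ψ ^ 2 + SS 1 2 χ ψ :=
    pair_sum 1 χ ψ
  have h3 : ∑ σ : Equiv.Perm (Fin 2), ∑ y ∈ AA F σ, gg 1 χ ψ y =
      ∑ σ : Equiv.Perm (Fin 2), ∑ y ∈ AA F σ, χ (cf y 0) * ψ (-cf y 1) := by
    refine sum_congr rfl fun σ _ => sum_congr rfl fun y hy => ?_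
    have c0 := alg_cf σ (perm2_pow σ) hy 0
    have c1 := alg_cf σ (perm2_pow σ) hy 1
    obtain ⟨d0, d1⟩ := coeff_two y
    apply gg_eq
    · rw [c0]; simpa using d0.symm
    · rw [map_neg, c1]; simpa using (congrArg Neg.neg d1).symm
  rw [h3, h, sum_fin2 (fun a b => χ a * ψ (-b))] at h2
  have h4 : ∑ b : F, ψ (-b) = 0 := by
    exact (Equiv.sum_comp (Equiv.neg F) (fun b => ψ b)).trans (AddChar.sum_eq_zero_of_ne_one hψ)
  simp_rw [← mul_sum, h4] at h2
  rw [SS_one] at h2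
  simp at h2
  linear_combination -h2

lemma three_one (χ : MulChar F ℂ) (ψ : AddChar F ℂ) (hψ : ψ ≠ 1) :
    SS 1 3 χ ψ = gaussSum χ ψ ^ 3 := by
  have h := sum_main (F := F) perm3_pow (fun c => χ (-c 0) * ψ (-c 2))
  have h2 := triple_sum 1 χ ψ
  have h3 : ∑ σ : Equiv.Perm (Fin 3), ∑ y ∈ AA F σ, gg 1 χ ψ y =
      ∑ σ : Equiv.Perm (Fin 3), ∑ y ∈ AA F σ, χ (-cf y 0) * ψ (-cf y 2) := by
    refine sum_congr rfl fun σ _ => sum_congr rfl fun y hy => ?_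
    have c0 := alg_cf σ (perm3_pow σ) hy 0
    have c2 := alg_cf σ (perm3_pow σ) hy 2
    obtain ⟨d0, d1, d2⟩ := coeff_three y
    apply gg_eq
    · rw [map_neg, c0]; simpa [Fin.prod_univ_three] using (congrArg Neg.neg d0).symm
    · rw [map_neg, c2]; simpa [Fin.sum_univ_three] using (congrArg Neg.neg d2).symm
  rw [h3, h, sum_fin3 (fun a b c => χ (-a) * ψ (-c))] at h2
  have h4 : ∑ b : F, ψ (-b) = 0 := by
    exact (Equiv.sum_comp (Equiv.neg F) (fun b => ψ b)).trans (AddChar.sum_eq_zero_of_ne_one hψ)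
  simp_rw [← mul_sum, h4] at h2
  rw [SS_one, two_one χ ψ hψ] at h2
  simp at h2
  linear_combination -h2 / 2

lemma hd_two (T ρ : MulChar F ℂ) (ψ : AddChar F ℂ) (hψ : ψ ≠ 1) (h2 : 2 ∣ qq - 1)
    (hρ : ρ ^ 2 = 1) (hρ' : ∀ a : F, a ≠ 0 → ρ a = 1 → a ^ ((qq - 1) / 2) = 1) :
    gaussSum T ψ * gaussSum (T * ρ) ψ =
      (∑ x : F, (T ^ 2) x * ψ (-(2 * x))) * ∑ x : F, ψ (x ^ 2) := by
  have h := sum_main (F := F) perm2_pow (fun c => (T ^ 2) (c 0) * ψ (-(2 * c 0)) * ψ ((c 1) ^ 2))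
  have hp := pair_sum 2 T ψ
  have h3 : ∑ σ : Equiv.Perm (Fin 2), ∑ y ∈ AA F σ, gg 2 T ψ y =
      ∑ σ : Equiv.Perm (Fin 2), ∑ y ∈ AA F σ,
        (T ^ 2) (cf y 0) * ψ (-(2 * cf y 0)) * ψ ((cf y 1) ^ 2) := by
    refine sum_congr rfl fun σ _ => sum_congr rfl fun y hy => ?_
    have c0 := alg_cf σ (perm2_pow σ) hy 0
    have c1 := alg_cf σ (perm2_pow σ) hy 1
    obtain ⟨d0, d1⟩ := coeff_two y
    simp only [Fin.val_zero, Fin.val_one, d0, d1] at c0 c1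
    rw [mul_assoc, ← AddChar.map_add_eq_mul, MulChar.pow_apply' _ two_ne_zero, ← map_pow]
    apply gg_eq
    · rw [map_pow, c0, Fin.prod_univ_two]; ring
    · simp only [map_add, map_neg, map_mul, map_pow, map_ofNat, c0, c1, Fin.sum_univ_two]; ring
  rw [h3, h, sum_fin2 (fun a b => (T ^ 2) a * ψ (-(2 * a)) * ψ (b ^ 2))] at hp
  rw [SS_cover h2 one_ne_zero T ρ ψ hρ hρ', SS_cover h2 two_ne_zero T ρ ψ hρ hρ'] at hp
  simp only [sum_range_succ, range_zero, sum_empty, SS_one, two_one _ ψ hψ, pow_zero, mul_one,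
    pow_one, zero_add, ← mul_sum, ← sum_mul] at hp
  norm_num at hp
  linear_combination -hp / 2

lemma hd_three (T ρ : MulChar F ℂ) (ψ : AddChar F ℂ) (hψ : ψ ≠ 1) (h3 : 3 ∣ qq - 1)
    (h30 : (3 : F) ≠ 0)
    (hρ : ρ ^ 3 = 1) (hρ' : ∀ a : F, a ≠ 0 → ρ a = 1 → a ^ ((qq - 1) / 3) = 1) :
    gaussSum T ψ * gaussSum (T * ρ) ψ * gaussSum (T * ρ ^ 2) ψ =
      (∑ x : F, (T ^ 3) x * ψ (3 * x)) * (qq : ℂ) := by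
  have h := sum_main (F := F) perm3_pow (fun c => (T ^ 3) (-c 0) * ψ (3 * (-c 0)) *
    (ψ (-(c 2) ^ 3) * ψ (c 1 * (3 * c 2))))
  have hp := triple_sum 3 T ψ
  have h3' : ∑ σ : Equiv.Perm (Fin 3), ∑ y ∈ AA F σ, gg 3 T ψ y =
      ∑ σ : Equiv.Perm (Fin 3), ∑ y ∈ AA F σ,
        (T ^ 3) (-cf y 0) * ψ (3 * (-cf y 0)) * (ψ (-(cf y 2) ^ 3) * ψ (cf y 1 * (3 * cf y 2))) := by
    refine sum_congr rfl fun σ _ => sum_congr rfl fun y hy => ?_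
    have c0 := alg_cf σ (perm3_pow σ) hy 0
    have c1 := alg_cf σ (perm3_pow σ) hy 1
    have c2 := alg_cf σ (perm3_pow σ) hy 2
    obtain ⟨d0, d1, d2⟩ := coeff_three y
    simp only [Fin.val_zero, Fin.val_one, Fin.val_two, d0, d1, d2] at c0 c1 c2
    rw [mul_assoc, ← AddChar.map_add_eq_mul, ← AddChar.map_add_eq_mul,
      MulChar.pow_apply' _ three_ne_zero, ← map_pow]
    apply gg_eq
    · rw [map_pow, map_neg, c0, Fin.prod_univ_three]; ring
    · simp only [map_add, map_neg, map_mul, map_pow, map_ofNat, c0, c1, c2, Fin.sum_univ_three]; ring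
  rw [h3', h, sum_fin3 (fun a b c => (T ^ 3) (-a) * ψ (3 * (-a)) *
    (ψ (-c ^ 3) * ψ (b * (3 * c))))] at hp
  have e1 : ∑ b : F, ∑ c : F, ψ (-c ^ 3) * ψ (b * (3 * c)) = qq := by
    rw [sum_comm]
    simp_rw [← mul_sum, AddChar.sum_mulShift _ (AddChar.IsPrimitive.of_ne_one hψ), mul_eq_zero, h30,
      false_or]
    simp
  have e2 : ∑ a : F, (T ^ 3) (-a) * ψ (3 * (-a)) = ∑ x : F, (T ^ 3) x * ψ (3 * x) :=
    Equiv.sum_comp (Equiv.neg F) (fun x => (T ^ 3) x * ψ (3 * x))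
  rw [SS_cover h3 one_ne_zero T ρ ψ hρ hρ', SS_cover h3 two_ne_zero T ρ ψ hρ hρ',
    SS_cover h3 three_ne_zero T ρ ψ hρ hρ'] at hp
  simp only [sum_range_succ, range_zero, sum_empty, SS_one, two_one _ ψ hψ, three_one _ ψ hψ,
    pow_zero, mul_one, pow_one, zero_add, ← mul_sum, ← sum_mul, e1, e2] at hp
  norm_num [Nat.factorial] at hp
  linear_combination -hp / 6

end cover
end HD
namespace HD
open Polynomial Finset
section final
variable {F : Type} [Field F] [Fintype F]

local notation "qq" => Fintype.card F

lemma gauss_shift (χ : MulChar F ℂ) (ψ : AddChar F ℂ) (a : F) (ha : a ≠ 0) :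
    ∑ x, χ x * ψ (a * x) = (χ a)⁻¹ * gaussSum χ ψ := by
  have h := gaussSum_mulShift χ ψ (Units.mk0 a ha)
  have hne : χ a ≠ 0 := by
    have := (IsUnit.mk0 a ha).map χ
    exact this.ne_zero
  rw [Units.val_mk0] at h
  rw [← h, inv_mul_cancel_left₀ hne]
  simp [gaussSum, AddChar.mulShift_apply]

lemma gauss_one (ψ : AddChar F ℂ) (hψ : ψ ≠ 1) : gaussSum (1 : MulChar F ℂ) ψ = -1 := by
  exact gaussSum_one_left hψ

lemma hd2 (T ρ : MulChar F ℂ) (ψ : AddChar F ℂ) (hψ : ψ ≠ 1) (h2 : 2 ∣ qq - 1) (h20 : (2 : F) ≠ 0)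
    (hρ : ρ ^ 2 = 1) (hρ' : ∀ a : F, a ≠ 0 → ρ a = 1 → a ^ ((qq - 1) / 2) = 1) :
    gaussSum T ψ * gaussSum (T * ρ) ψ = ((T ^ 2) 2)⁻¹ * gaussSum (T ^ 2) ψ * gaussSum ρ ψ := by
  have hs : ∀ T : MulChar F ℂ, ∑ x : F, (T ^ 2) x * ψ (-(2 * x)) =
      ((T ^ 2) 2)⁻¹ * gaussSum (T ^ 2) ψ := by
    intro T
    have := gauss_shift (T ^ 2) ψ (-2) (neg_ne_zero.mpr h20)
    have e : (T ^ 2) (-2) = (T ^ 2) 2 := by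
      rw [MulChar.pow_apply' _ two_ne_zero, MulChar.pow_apply' _ two_ne_zero, ← map_pow, ← map_pow,
        neg_sq]
    rw [← e, ← this]
    simp only [neg_mul]
  have h1 := hd_two 1 ρ ψ hψ h2 hρ hρ'
  rw [hs, one_pow, one_mul, gauss_one ψ hψ, MulChar.one_apply (isUnit_iff_ne_zero.mpr h20)] at h1
  have hC : gaussSum ρ ψ = ∑ x : F, ψ (x ^ 2) := by
    rw [inv_one] at h1; linear_combination -h1
  rw [hd_two T ρ ψ hψ h2 hρ hρ', hs, hC]

lemma hd3 (T ρ : MulChar F ℂ) (ψ : AddChar F ℂ) (hψ : ψ ≠ 1) (h3 : 3 ∣ qq - 1)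
    (h30 : (3 : F) ≠ 0)
    (hρ : ρ ^ 3 = 1) (hρ' : ∀ a : F, a ≠ 0 → ρ a = 1 → a ^ ((qq - 1) / 3) = 1) :
    gaussSum T ψ * gaussSum (T * ρ) ψ * gaussSum (T * ρ ^ 2) ψ =
      ((T ^ 3) 3)⁻¹ * gaussSum (T ^ 3) ψ * (qq : ℂ) := by
  rw [hd_three T ρ ψ hψ h3 h30 hρ hρ', gauss_shift _ _ _ h30]

lemma hd6 (T χ : MulChar F ℂ) (ψ : AddChar F ℂ) (hψ : ψ ≠ 1) (h6 : 6 ∣ qq - 1)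
    (h20 : (2 : F) ≠ 0) (h30 : (3 : F) ≠ 0) (hχ : χ ^ 6 = 1)
    (h2' : ∀ a : F, a ≠ 0 → (χ ^ 3) a = 1 → a ^ ((qq - 1) / 2) = 1)
    (h3' : ∀ a : F, a ≠ 0 → (χ ^ 2) a = 1 → a ^ ((qq - 1) / 3) = 1) :
    gaussSum T ψ * gaussSum (T * χ) ψ * gaussSum (T * χ ^ 2) ψ * gaussSum (T * χ ^ 3) ψ *
      gaussSum (T * χ ^ 4) ψ * gaussSum (T * χ ^ 5) ψ =
    ((T ^ 6) 6)⁻¹ * gaussSum (T ^ 6) ψ * (qq * gaussSum (χ ^ 3) ψ ^ 3) := by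
  have d2 : 2 ∣ qq - 1 := dvd_trans (by norm_num) h6
  have d3 : 3 ∣ qq - 1 := dvd_trans (by norm_num) h6
  have r2 : (χ ^ 3) ^ 2 = 1 := by rw [← pow_mul, hχ]
  have r3 : (χ ^ 2) ^ 3 = 1 := by rw [← pow_mul, hχ]
  have a1 := hd2 T (χ ^ 3) ψ hψ d2 h20 r2 h2'
  have a2 := hd2 (T * χ ^ 2) (χ ^ 3) ψ hψ d2 h20 r2 h2'
  have a3 := hd2 (T * χ ^ 4) (χ ^ 3) ψ hψ d2 h20 r2 h2'
  have a4 := hd3 (T ^ 2) (χ ^ 2) ψ hψ d3 h30 r3 h3'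
  have e1 : T * χ ^ 2 * χ ^ 3 = T * χ ^ 5 := by rw [mul_assoc, ← pow_add]
  have e2 : T * χ ^ 4 * χ ^ 3 = T * χ := by
    rw [mul_assoc, ← pow_add, show 4 + 3 = 6 + 1 from rfl, pow_add, hχ]; simp
  have e3 : (T * χ ^ 2) ^ 2 = T ^ 2 * (χ ^ 2) ^ 2 := by rw [mul_pow]
  have e4 : (T * χ ^ 4) ^ 2 = T ^ 2 * χ ^ 2 := by
    rw [mul_pow, ← pow_mul, show 4 * 2 = 6 + 2 from rfl, pow_add, hχ, one_mul]
  have e5 : (T ^ 2) ^ 3 = T ^ 6 := by rw [← pow_mul]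
  rw [e1, e3] at a2
  rw [e2, e4] at a3
  rw [e5] at a4
  have ev : (T ^ 2) 2 * (T ^ 2 * (χ ^ 2) ^ 2) 2 * (T ^ 2 * χ ^ 2) 2 * (T ^ 6) 3 = (T ^ 6) 6 := by
    rw [← MulChar.mul_apply, ← MulChar.mul_apply]
    have : T ^ 2 * (T ^ 2 * (χ ^ 2) ^ 2) * (T ^ 2 * χ ^ 2) = T ^ 6 * χ ^ 6 := by
      rw [show T ^ 6 = T ^ 2 * T ^ 2 * T ^ 2 by simp only [← pow_add],
        show χ ^ 6 = (χ ^ 2) ^ 2 * χ ^ 2 by rw [← pow_mul, ← pow_add]]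
      ac_rfl
    rw [this, hχ, mul_one, ← map_mul]; norm_num
  rw [← ev, mul_inv, mul_inv, mul_inv]
  calc _ = (gaussSum T ψ * gaussSum (T * χ ^ 3) ψ) * (gaussSum (T * χ ^ 2) ψ * gaussSum (T * χ ^ 5) ψ)
      * (gaussSum (T * χ ^ 4) ψ * gaussSum (T * χ) ψ) := by ring
    _ = _ := by
      rw [a1, a2, a3]
      linear_combination (((T ^ 2) 2)⁻¹ * ((T ^ 2 * (χ ^ 2) ^ 2) 2)⁻¹ * ((T ^ 2 * χ ^ 2) 2)⁻¹ *
        gaussSum (χ ^ 3) ψ ^ 3) * a4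

lemma gauss_inv (A : MulChar F ℂ) (ψ : AddChar F ℂ) (hψ : ψ ≠ 1) :
    (gaussSum A ψ)⁻¹ = A (-1) * gaussSum A⁻¹ ψ / qq + if A = 1 then (-1 + 1 / (qq : ℂ)) else 0 := by
  have hq : (qq : ℂ) ≠ 0 := by exact_mod_cast Fintype.card_ne_zero
  split_ifs with h
  · subst h
    rw [inv_one, gauss_one ψ hψ, MulChar.one_apply isUnit_one.neg]; field_simp; ring
  · have hp := AddChar.IsPrimitive.of_ne_one hψ
    have h1 := gaussSum_mul_gaussSum_eq_card h hp
    have h2 := mul_gaussSum_inv_eq_gaussSum A⁻¹ ψ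
    rw [MulChar.inv_apply', inv_neg, inv_one] at h2
    have hs : A (-1) * A (-1) = 1 := by rw [← map_mul]; simp
    rw [add_zero]
    apply inv_eq_of_mul_eq_one_right
    rw [← h2]
    field_simp
    linear_combination A (-1) * A (-1) * h1 + (qq : ℂ) * hs

lemma gauss_ne (A : MulChar F ℂ) (ψ : AddChar F ℂ) (hψ : ψ ≠ 1) : gaussSum A ψ ≠ 0 := by
  have hq : (qq : ℂ) ≠ 0 := by exact_mod_cast Fintype.card_ne_zero
  by_cases h : A = 1
  · subst h; rw [gauss_one ψ hψ]; norm_num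
  · exact gaussSum_ne_zero_of_nontrivial hq h (AddChar.IsPrimitive.of_ne_one hψ)

lemma faithful (ω : MulChar F ℂ) (hω : ∀ χ : MulChar F ℂ, ∃ j : ℕ, χ = ω ^ j) (a : F)
    (ha : ω a = 1) : a = 1 := by
  by_contra h
  have : NeZero (Monoid.exponent Fˣ) := ⟨Monoid.exponent_ne_zero_of_finite⟩
  obtain ⟨χ, hχ⟩ := MulChar.exists_apply_ne_one_of_hasEnoughRootsOfUnity F ℂ h
  obtain ⟨j, rfl⟩ := hω χ
  have h0 : a ≠ 0 := by rintro rfl; rw [MulChar.map_nonunit ω not_isUnit_zero] at ha; exact zero_ne_one ha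
  apply hχ
  have := MulChar.pow_apply_coe ω j (Units.mk0 a h0)
  rw [Units.val_mk0] at this
  rw [this, ha, one_pow]

lemma order_omega (ω : MulChar F ℂ) (hω : ∀ χ : MulChar F ℂ, ∃ j : ℕ, χ = ω ^ j) :
    orderOf ω = qq - 1 := by
  have : NeZero (Monoid.exponent Fˣ) := ⟨Monoid.exponent_ne_zero_of_finite⟩
  rw [← Fintype.card_units, ← Nat.card_eq_fintype_card,
    ← MulChar.card_eq_card_units_of_hasEnoughRootsOfUnity F ℂ]
  apply orderOf_eq_card_of_forall_mem_powers
  intro χ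
  obtain ⟨j, hj⟩ := hω χ
  exact ⟨j, hj.symm⟩

lemma pow_app (ω : MulChar F ℂ) (j : ℕ) (a : F) (ha : a ≠ 0) : (ω ^ j) a = ω a ^ j := by
  have := MulChar.pow_apply_coe ω j (Units.mk0 a ha)
  rwa [Units.val_mk0] at this

lemma ortho (ω : MulChar F ℂ) (hω : ∀ χ : MulChar F ℂ, ∃ j : ℕ, χ = ω ^ j) (u : F) :
    ∑ j ∈ range (qq - 1), (ω ^ j) u = if u = 1 then ((qq : ℂ) - 1) else 0 := by
  have hq1 : 1 < qq := Fintype.one_lt_card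
  split_ifs with h
  · subst h
    simp [Nat.cast_sub hq1.le]
  · by_cases h0 : u = 0
    · subst h0; exact sum_eq_zero fun j _ => MulChar.map_nonunit _ not_isUnit_zero
    · simp_rw [pow_app ω _ u h0]
      have h1 : ω u ≠ 1 := fun h1 => h (faithful ω hω u h1)
      rw [geom_sum_eq h1, ← map_pow, FiniteField.pow_card_sub_one_eq_one u h0]; simp

lemma conv_sum (ω : MulChar F ℂ) (hω : ∀ χ : MulChar F ℂ, ∃ j : ℕ, χ = ω ^ j) (ψ : AddChar F ℂ)
    (A : MulChar F ℂ) (c : F) (hc0 : c ≠ 0) (hc1 : c ≠ 1) :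
    ∑ j ∈ range (qq - 1), (ω ^ j) (-c) * (gaussSum (ω ^ j) ψ * gaussSum ((ω ^ j)⁻¹ * A) ψ) =
      ((qq : ℂ) - 1) * (A (-c) * (A (1 - c))⁻¹ * gaussSum A ψ) := by
  have e1 : ∀ j, (ω ^ j) (-c) * (gaussSum (ω ^ j) ψ * gaussSum ((ω ^ j)⁻¹ * A) ψ) =
      ∑ x : F, ∑ y : F, (ω ^ j) (-c * x * y⁻¹) * (A y * ψ (x + y)) := by
    intro j
    rw [gaussSum, gaussSum, sum_mul_sum, mul_sum]
    refine sum_congr rfl fun x _ => ?_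
    rw [mul_sum]
    refine sum_congr rfl fun y _ => ?_
    rw [MulChar.mul_apply, MulChar.inv_apply', map_mul, map_mul, AddChar.map_add_eq_mul]; ring
  simp_rw [e1]
  rw [sum_comm]
  have e2 : ∀ x : F, ∑ j ∈ range (qq - 1), ∑ y : F, (ω ^ j) (-c * x * y⁻¹) * (A y * ψ (x + y)) =
      ((qq : ℂ) - 1) * (A (-c) * (A x * ψ ((1 - c) * x))) := by
    intro x
    rw [sum_comm]
    simp_rw [← sum_mul, ortho ω hω]
    rw [sum_eq_single (-c * x)]
    · by_cases hx : x = 0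
      · subst hx; simp [MulChar.map_nonunit A not_isUnit_zero]
      · rw [if_pos (mul_inv_cancel₀ (mul_ne_zero (neg_ne_zero.mpr hc0) hx)), map_mul]
        rw [show x + -c * x = (1 - c) * x by ring]; ring
    · intro y _ hy
      by_cases hy0 : y = 0
      · subst hy0; simp [MulChar.map_nonunit A not_isUnit_zero]
      · rw [if_neg, zero_mul]
        intro h
        apply hy
        field_simp at h
        rw [← h]; ring
    · simp
  simp_rw [e2]
  rw [← mul_sum, ← mul_sum, gauss_shift A ψ (1 - c) (sub_ne_zero.mpr hc1.symm)]
  ring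

lemma psi_exists (p : ℕ) [Fact p.Prime] (F : Type) [Field F] [Fintype F] [Algebra (ZMod p) F] :
    ∃ ψ : AddChar F ℂ, ψ ≠ 1 ∧ ∀ χ : MulChar F ℂ, gaussChar p F χ = gaussSum χ ψ := by
  refine ⟨(ZMod.stdAddChar (N := p)).compAddMonoidHom (Algebra.trace (ZMod p) F).toAddMonoidHom,
    ?_, ?_⟩
  · intro h
    obtain ⟨x, hx⟩ := Algebra.trace_surjective (ZMod p) F 1
    have h1 := DFunLike.congr_fun h x
    simp only [AddChar.compAddMonoidHom_apply, LinearMap.toAddMonoidHom_coe, hx,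
      AddChar.one_apply] at h1
    have := ZMod.injective_stdAddChar (N := p) (h1.trans (AddChar.map_zero_eq_one _).symm)
    exact one_ne_zero this
  · intro χ
    rw [gaussChar, gaussSum]
    refine sum_congr rfl fun x _ => ?_
    rw [AddChar.compAddMonoidHom_apply, LinearMap.toAddMonoidHom_coe, ZMod.stdAddChar_apply,
      ZMod.toCircle_apply]

lemma main_sum (ψ : AddChar F ℂ) (hψ : ψ ≠ 1) (t : ℕ) (ht : qq - 1 = 6 * t) (ω : MulChar F ℂ)
    (hω : ∀ χ : MulChar F ℂ, ∃ j : ℕ, χ = ω ^ j) (c : F) (hc0 : c ≠ 0) (hc1 : c ≠ 1)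
    (hc : (ω ^ (3 * t)) c = 1) :
    ∑ j ∈ range (qq - 1), gaussSum (ω ^ j) ψ / gaussSum (ω ^ j * ω ^ (3 * t)) ψ * (ω ^ j) c =
      ((qq : ℂ) - 1) / qq * gaussSum (ω ^ (3 * t)) ψ * ((ω ^ (3 * t)) (1 - c) - 1) := by
  have hq1 : 1 < qq := Fintype.one_lt_card
  have hqc : (qq : ℂ) ≠ 0 := by exact_mod_cast Fintype.card_ne_zero
  have hord := order_omega ω hω
  have h2 : ω ^ (3 * t) * ω ^ (3 * t) = 1 := by
    rw [← pow_add, show 3 * t + 3 * t = orderOf ω by omega, pow_orderOf_eq_one]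
  set A := ω ^ (3 * t) with hA
  have hinv : A⁻¹ = A := inv_eq_of_mul_eq_one_right h2
  have hsq : ∀ a : F, a ≠ 0 → A a * A a = 1 := by
    intro a ha
    rw [← MulChar.mul_apply, h2, MulChar.one_apply (isUnit_iff_ne_zero.mpr ha)]
  have hn1 := hsq (-1) (by simp)
  have hc' := hsq (1 - c) (sub_ne_zero.mpr hc1.symm)
  have e1 : ∀ j ∈ range (qq - 1), gaussSum (ω ^ j) ψ / gaussSum (ω ^ j * A) ψ * (ω ^ j) c =
      A (-1) / qq * ((ω ^ j) (-c) * (gaussSum (ω ^ j) ψ * gaussSum ((ω ^ j)⁻¹ * A) ψ)) +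
      (if j = 3 * t then (-1 + 1 / (qq : ℂ)) * gaussSum A ψ else 0) := by
    intro j hj
    rw [mem_range] at hj
    have hiff : ω ^ j * A = 1 ↔ j = 3 * t := by
      rw [hA, ← pow_add]
      constructor
      · intro h
        have := orderOf_dvd_of_pow_eq_one h
        rw [hord] at this
        obtain ⟨d, hd⟩ := this
        rw [ht] at hd hj
        have : d = 1 := by
          rcases d with _ | _ | d
          · omega
          · rfl
          · exfalso; nlinarith [Nat.zero_le (t * d)]
        subst this; omega
      · rintro rfl
        rw [pow_add]; exact h2
    rw [div_eq_mul_inv, gauss_inv _ ψ hψ, mul_inv, hinv, MulChar.mul_apply]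
    simp only [hiff]
    rw [show -c = (-1) * c by ring, map_mul]
    split_ifs with h
    · subst h
      rw [← hA, hc]; ring
    · ring
  rw [sum_congr rfl e1, sum_add_distrib, ← mul_sum, conv_sum ω hω ψ A c hc0 hc1, sum_ite_eq',
    if_pos (by rw [mem_range]; omega), inv_eq_of_mul_eq_one_right hc',
    show -c = (-1) * c by ring, map_mul, hc]
  field_simp
  linear_combination (((qq : ℂ) - 1) * A (1 - c) * gaussSum A ψ) * hn1

end final
end HD

/-- The contribution of the class of `w = (0,0,1,2,4,5)` in Koblitz's formula. -/
theorem class_001245 (p e q t : ℕ) [Fact p.Prime] (F : Type) [Field F] [Fintype F]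
    [Algebra (ZMod p) F]
    (he : 0 < e) (hq : q = Fintype.card F) (hqe : q = p ^ e) (hmod : q % 6 = 1)
    (ht : t = (q - 1) / 6)
    (ω : MulChar F ℂ) (hω : ∀ χ : MulChar F ℂ, ∃ j : ℕ, χ = ω ^ j)
    (ω₂ : MulChar F ℂ) (hω₂ : ω₂ = ω ^ (3 * t))
    (lam : F) (hlam : lam ≠ 0) (hlam6 : lam ^ 6 ≠ 1) :
    (∑ k ∈ Finset.range 6, NqW p F ω 6 (fun i => (![0,0,1,2,4,5] : Fin 6 → ZMod 6) i + (k : ZMod 6))) +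
      SW p F ω 6 (fun _ => 1) (![0,0,1,2,4,5] : Fin 6 → ZMod 6) lam =
      (q : ℂ) ^ 2 * ω₂ (1 - lam ^ 6) := by
  subst hq
  obtain ⟨ψ, hψ, hg⟩ := HD.psi_exists p F
  have hq1 : 1 < Fintype.card F := Fintype.one_lt_card
  have hqc : (Fintype.card F : ℂ) ≠ 0 := by exact_mod_cast Fintype.card_ne_zero
  have hqc1 : (Fintype.card F : ℂ) - 1 ≠ 0 := by
    rw [sub_ne_zero]; exact_mod_cast hq1.ne'
  have ht6 : Fintype.card F - 1 = 6 * t := by omega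
  have hord := HD.order_omega ω hω
  have hcast : ((Fintype.card F : ℕ) : F) = 0 := FiniteField.cast_card_eq_zero F
  have hcast6 : (6 : F) * t + 1 = 0 := by
    have : Fintype.card F = 6 * t + 1 := by omega
    rw [this] at hcast
    push_cast at hcast
    exact hcast
  have h20 : (2 : F) ≠ 0 := by
    intro h
    have : (1 : F) = 0 := by linear_combination hcast6 - 3 * (t : F) * h
    exact one_ne_zero this
  have h30 : (3 : F) ≠ 0 := by
    intro h
    have : (1 : F) = 0 := by linear_combination hcast6 - 2 * (t : F) * h
    exact one_ne_zero this
  have h60 : (6 : F) ≠ 0 := by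
    intro h
    have : (1 : F) = 0 := by linear_combination hcast6 - (t : F) * h
    exact one_ne_zero this
  have hχ6 : (ω ^ t) ^ 6 = 1 := by
    rw [← pow_mul, show t * 6 = orderOf ω by omega, pow_orderOf_eq_one]
  have hfa : ∀ (k : ℕ) (a : F), a ≠ 0 → (ω ^ k) a = 1 → a ^ k = 1 := by
    intro k a ha h
    rw [HD.pow_app ω k a ha, ← map_pow] at h
    exact HD.faithful ω hω _ h
  have h2' : ∀ a : F, a ≠ 0 → ((ω ^ t) ^ 3) a = 1 → a ^ ((Fintype.card F - 1) / 2) = 1 := by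
    intro a ha h
    rw [← pow_mul] at h
    rw [show (Fintype.card F - 1) / 2 = t * 3 by omega]
    exact hfa _ a ha h
  have h3' : ∀ a : F, a ≠ 0 → ((ω ^ t) ^ 2) a = 1 → a ^ ((Fintype.card F - 1) / 3) = 1 := by
    intro a ha h
    rw [← pow_mul] at h
    rw [show (Fintype.card F - 1) / 3 = t * 2 by omega]
    exact hfa _ a ha h
  have hP := fun T => HD.hd6 T (ω ^ t) ψ hψ ⟨t, ht6⟩ h20 h30 hχ6 h2' h3'
  set G : MulChar F ℂ → ℂ := fun χ => gaussSum χ ψ with hG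
  have hχ3 : (ω ^ t) ^ 3 = ω₂ := by rw [hω₂, ← pow_mul, mul_comm]
  have hω₂2 : ω₂ * ω₂ = 1 := by rw [← hχ3, ← pow_add, hχ6]
  have hω₂1 : ω₂ ≠ 1 := by
    rw [hω₂]; intro h
    have := orderOf_dvd_of_pow_eq_one h
    have := Nat.le_of_dvd (by omega) this
    omega
  have hsq : G ω₂ * G ω₂ = ω₂ (-1) * Fintype.card F := by
    have h := HD.gauss_inv ω₂ ψ hψ
    rw [if_neg hω₂1, inv_eq_of_mul_eq_one_right hω₂2, add_zero] at h
    have hne := HD.gauss_ne ω₂ ψ hψ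
    have hs : ω₂ (-1) * ω₂ (-1) = 1 := by rw [← map_mul]; simp
    change gaussSum ω₂ ψ * gaussSum ω₂ ψ = _
    field_simp at h
    linear_combination (-ω₂ (-1)) * h - gaussSum ω₂ ψ ^ 2 * hs
  have h4 : G ω₂ ^ 4 = (Fintype.card F : ℂ) ^ 2 := by
    have hs : ω₂ (-1) * ω₂ (-1) = 1 := by rw [← map_mul]; simp
    linear_combination (G ω₂ * G ω₂ + ω₂ (-1) * Fintype.card F) * hsq + (Fintype.card F : ℂ) ^ 2 * hs
  have hgt : (Fintype.card F - 1) / 6 = t := by omega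
  -- the diagonal part
  have hN : (∑ k ∈ Finset.range 6,
      NqW p F ω 6 (fun i => (![0,0,1,2,4,5] : Fin 6 → ZMod 6) i + (k : ZMod 6))) =
      (Fintype.card F : ℂ) ^ 2 := by
    have hz : ∀ w : Fin 6 → ZMod 6, (¬ ∀ i, w i = 0) → (¬ ∀ i, w i ≠ 0) → NqW p F ω 6 w = 0 := by
      intro w h1 h2
      rw [NqW, if_neg h1, if_neg h2]
    have hk3 : NqW p F ω 6 (fun i => (![0,0,1,2,4,5] : Fin 6 → ZMod 6) i + ((3 : ℕ) : ZMod 6)) =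
        (Fintype.card F : ℂ) ^ 2 := by
      rw [NqW, if_neg (by decide), if_pos (by decide), Fin.prod_univ_six, hgt]
      have v0 : ((![0,0,1,2,4,5] : Fin 6 → ZMod 6) 0 + ((3 : ℕ) : ZMod 6)).val = 3 := by decide
      have v1 : ((![0,0,1,2,4,5] : Fin 6 → ZMod 6) 1 + ((3 : ℕ) : ZMod 6)).val = 3 := by decide
      have v2 : ((![0,0,1,2,4,5] : Fin 6 → ZMod 6) 2 + ((3 : ℕ) : ZMod 6)).val = 4 := by decide
      have v3 : ((![0,0,1,2,4,5] : Fin 6 → ZMod 6) 3 + ((3 : ℕ) : ZMod 6)).val = 5 := by decide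
      have v4 : ((![0,0,1,2,4,5] : Fin 6 → ZMod 6) 4 + ((3 : ℕ) : ZMod 6)).val = 1 := by decide
      have v5 : ((![0,0,1,2,4,5] : Fin 6 → ZMod 6) 5 + ((3 : ℕ) : ZMod 6)).val = 2 := by decide
      rw [v0, v1, v2, v3, v4, v5]
      simp only [hg]
      have h1 := hP 1
      simp only [one_mul, one_pow, HD.gauss_one ψ hψ, hχ3,
        MulChar.one_apply (isUnit_iff_ne_zero.mpr h60), inv_one] at h1
      rw [← h4, ← hω₂, one_mul, mul_comm 4 t, mul_comm 5 t, mul_comm 2 t, pow_mul, pow_mul, pow_mul]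
      change _ = gaussSum ω₂ ψ ^ 4
      field_simp
      linear_combination (-gaussSum ω₂ ψ) * h1
    rw [Finset.sum_eq_single 3]
    · exact hk3
    · intro k hk hk3
      rw [Finset.mem_range] at hk
      apply hz
      · interval_cases k <;> decide
      · interval_cases k <;> first | decide | exact absurd rfl hk3
    · intro h; exact absurd (Finset.mem_range.mpr (by norm_num)) h
  have hc0 : lam ^ 6 ≠ 0 := pow_ne_zero _ hlam
  have hcω : (ω ^ (3 * t)) (lam ^ 6) = 1 := by
    rw [← hω₂, map_pow, show 6 = 2 * 3 from rfl, pow_mul, sq, ← MulChar.mul_apply, hω₂2,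
      MulChar.one_apply (isUnit_iff_ne_zero.mpr hlam), one_pow]
  have hM := HD.main_sum ψ hψ t ht6 ω hω (lam ^ 6) hc0 hlam6 hcω
  have hS : SW p F ω 6 (fun _ => 1) (![0,0,1,2,4,5] : Fin 6 → ZMod 6) lam =
      (Fintype.card F : ℂ) ^ 2 * (ω₂ (1 - lam ^ 6) - 1) := by
    rw [SW, hgt]
    have hterm : ∀ j ∈ Finset.range (Fintype.card F - 1),
        (∏ i, gaussChar p F (ω ^ (((![0,0,1,2,4,5] : Fin 6 → ZMod 6) i).val * t + 1 * j))) /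
          gaussChar p F (ω ^ (6 * j)) * (ω ^ (6 * j)) (((6 : ℕ) : F) * lam) =
        (Fintype.card F * gaussSum ω₂ ψ ^ 3) *
        (gaussSum (ω ^ j) ψ / gaussSum (ω ^ j * ω ^ (3 * t)) ψ * (ω ^ j) (lam ^ 6)) := by
      intro j _
      have v0 : ((![0,0,1,2,4,5] : Fin 6 → ZMod 6) 0).val = 0 := by decide
      have v1 : ((![0,0,1,2,4,5] : Fin 6 → ZMod 6) 1).val = 0 := by decide
      have v2 : ((![0,0,1,2,4,5] : Fin 6 → ZMod 6) 2).val = 1 := by decide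
      have v3 : ((![0,0,1,2,4,5] : Fin 6 → ZMod 6) 3).val = 2 := by decide
      have v4 : ((![0,0,1,2,4,5] : Fin 6 → ZMod 6) 4).val = 4 := by decide
      have v5 : ((![0,0,1,2,4,5] : Fin 6 → ZMod 6) 5).val = 5 := by decide
      rw [Fin.prod_univ_six, v0, v1, v2, v3, v4, v5]
      simp only [hg, zero_mul, zero_add, one_mul]
      have hp := hP (ω ^ j)
      have ee : ∀ k : ℕ, ω ^ (k * t + j) = ω ^ j * (ω ^ t) ^ k := by
        intro k; rw [pow_add, mul_comm k t, pow_mul, mul_comm]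
      have ee1 : ω ^ (t + j) = ω ^ j * ω ^ t := by rw [pow_add, mul_comm]
      have e6 : (ω ^ j) ^ 6 = ω ^ (6 * j) := by rw [← pow_mul, mul_comm]
      rw [ee, ee, ee, ee1]
      rw [hχ3, e6] at hp
      have hev : (ω ^ (6 * j)) (((6 : ℕ) : F) * lam) = (ω ^ (6 * j)) 6 * (ω ^ j) (lam ^ 6) := by
        rw [map_mul, ← e6, map_pow, HD.pow_app (ω ^ j) 6 lam hlam]; norm_num
      have h6ne : (ω ^ (6 * j)) 6 ≠ 0 := ((IsUnit.mk0 _ h60).map (ω ^ (6 * j))).ne_zero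
      have n1 := HD.gauss_ne (ω ^ (6 * j)) ψ hψ
      have n2 := HD.gauss_ne (ω ^ j * ω₂) ψ hψ
      rw [hev, ← hω₂]
      field_simp at hp ⊢
      linear_combination (gaussSum (ω ^ j) ψ * (ω ^ j) (lam ^ 6)) * hp
    rw [Finset.sum_congr rfl hterm, ← Finset.mul_sum, hM, ← hω₂, ← h4]
    change _ = gaussSum ω₂ ψ ^ 4 * _
    field_simp
  rw [hN, hS]
  ring
end
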